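/- arXiv:1802.04481 — 8 statements merged into one kernel-verified Lean document; each statement's English description precedes it below -/
import Mathlib

section
/- For every k ≥ 1, the binary word aᵏ b aᵏ b a²ᵏ (of length 4k+2) contains at least k + (⌊k/2⌋+1)² + (k+1)·⌈k/2⌉ distinct abelian square factors. -/
/-- Two words are Parikh-equivalent (abelian-equivalent) if every letter occurs
the same number of times in each. -/
def ParikhEq {α : Type*} [DecidableEq α] (u v : List α) : Prop :=
  ∀ a : α, u.count a = v.count a

/-- A word is an abelian square if it is the concatenation of two nonempty
Parikh-equivalent words of the same length. -/
def AbelianSquare {α : Type*} [DecidableEq α] (w : List α) : Prop :=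
  ∃ u v : List α, u ≠ [] ∧ u.length = v.length ∧ ParikhEq u v ∧ w = u ++ v

/-- The binary word `aᵏ b aᵏ b a²ᵏ` (with `a = false`, `b = true`). -/
def kociumakaWord (k : ℕ) : List Bool :=
  List.replicate k false ++ [true] ++ List.replicate k false ++ [true] ++
    List.replicate (2 * k) false

/-- The factors `aⁱ b aᵏ b aʲ` with two occurrences of `b`. -/
def twoB (k i j : ℕ) : List Bool :=
  List.replicate i false ++ [true] ++ List.replicate k false ++ [true] ++ List.replicate j false

lemma sum_half (n : ℕ) : 4 * ∑ t ∈ Finset.range n, t / 2 + (n + 1) % 2 * 2 * n + (n % 2) * (2 * n)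
    = n * n + n % 2 := by
  induction n with
  | zero => simp
  | succ n ih =>
    rw [Finset.sum_range_succ]
    rcases Nat.even_or_odd' n with ⟨m, rfl | rfl⟩
    · have e1 : (2 * m + 1) % 2 = 1 := by omega
      have e2 : (2 * m) % 2 = 0 := by omega
      have e3 : (2 * m + 1 + 1) % 2 = 0 := by omega
      have e4 : 2 * m / 2 = m := by omega
      simp only [e1, e2, e3, e4] at ih ⊢
      nlinarith
    · have e1 : (2 * m + 1) % 2 = 1 := by omega
      have e3 : (2 * m + 1 + 1) % 2 = 0 := by omega
      have e5 : (2 * m + 1 + 1 + 1) % 2 = 1 := by omega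
      have e4 : (2 * m + 1) / 2 = m := by omega
      simp only [e1, e5, e3, e4] at ih ⊢
      nlinarith

lemma sum_formula (k : ℕ) : ∑ i ∈ Finset.range (k + 1), ((i + k) / 2 + 1)
    = (k / 2 + 1) ^ 2 + (k + 1) * ((k + 1) / 2) := by
  have h := Finset.sum_range_add (fun t => t / 2) k (k + 1)
  have h1 := sum_half (k + (k + 1))
  have h2 := sum_half k
  rw [Finset.sum_add_distrib]
  simp only [Finset.sum_const, Finset.card_range, smul_eq_mul, mul_one]
  have h3 : ∑ i ∈ Finset.range (k + 1), (i + k) / 2 = ∑ i ∈ Finset.range (k + 1), (k + i) / 2 :=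
    Finset.sum_congr rfl fun i _ => by rw [Nat.add_comm]
  rw [h3]
  rcases Nat.even_or_odd' k with ⟨m, rfl | rfl⟩
  · have e1 : (2 * m + (2 * m + 1) + 1) % 2 = 0 := by omega
    have e2 : (2 * m + (2 * m + 1)) % 2 = 1 := by omega
    have e3 : (2 * m + 1) % 2 = 1 := by omega
    have e4 : (2 * m) % 2 = 0 := by omega
    have e5 : (2 * m) / 2 = m := by omega
    have e6 : (2 * m + 1) / 2 = m := by omega
    simp only [e1, e2, e3, e4] at h1 h2
    rw [e5, e6]
    nlinarith
  · have e1 : (2 * m + 1 + (2 * m + 1 + 1) + 1) % 2 = 0 := by omega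
    have e2 : (2 * m + 1 + (2 * m + 1 + 1)) % 2 = 1 := by omega
    have e3 : (2 * m + 1 + 1) % 2 = 0 := by omega
    have e4 : (2 * m + 1) % 2 = 1 := by omega
    have e5 : (2 * m + 1) / 2 = m := by omega
    have e6 : (2 * m + 1 + 1) / 2 = m + 1 := by omega
    simp only [e1, e2, e3, e4] at h1 h2
    rw [e5, e6]
    nlinarith

lemma twoB_length (k i j : ℕ) : (twoB k i j).length = i + k + j + 2 := by
  simp [twoB]; omega

lemma twoB_count (k i j : ℕ) : (twoB k i j).count true = 2 := by
  simp [twoB, List.count_replicate]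

lemma twoB_idxOf (k i j : ℕ) : (twoB k i j).idxOf true = i := by
  unfold twoB
  simp only [List.append_assoc]
  rw [List.idxOf_append_of_notMem (by simp)]
  simp

lemma twoB_square (k i s : ℕ) (hi : i ≤ k) (hs : s ≤ (i + k) / 2) :
    AbelianSquare (twoB k i (i + k - 2 * s)) := by
  refine ⟨List.replicate i false ++ [true] ++ List.replicate (k - s) false,
    List.replicate s false ++ [true] ++ List.replicate (i + k - 2 * s) false, by simp, ?_, ?_, ?_⟩
  · simp; omega
  · intro a
    cases a
    · simp [List.count_replicate]; omega
    · simp [List.count_replicate]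
  · have : List.replicate k false
        = List.replicate (k - s) false ++ List.replicate s false := by
      rw [List.replicate_append_replicate]; congr 1; omega
    unfold twoB
    rw [this]
    simp only [List.append_assoc]

lemma twoB_infix (k i j : ℕ) (hi : i ≤ k) (hj : j ≤ 2 * k) :
    twoB k i j <:+: kociumakaWord k := by
  refine ⟨List.replicate (k - i) false, List.replicate (2 * k - j) false, ?_⟩
  have h1 : List.replicate k false
        = List.replicate (k - i) false ++ List.replicate i false := by
    rw [List.replicate_append_replicate]; congr 1; omega
  have h2 : List.replicate (2 * k) false
        = List.replicate j false ++ List.replicate (2 * k - j) false := by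
    rw [List.replicate_append_replicate]; congr 1; omega
  unfold kociumakaWord twoB
  rw [h2]
  nth_rewrite 2 [h1]
  simp only [List.append_assoc]

lemma rep_square (t : ℕ) : AbelianSquare (List.replicate (2 * (t + 1)) false) := by
  refine ⟨List.replicate (t + 1) false, List.replicate (t + 1) false, by simp, rfl,
    fun _ => rfl, ?_⟩
  rw [List.replicate_append_replicate]; congr 1; omega

lemma rep_infix (k n : ℕ) (hn : n ≤ 2 * k) :
    List.replicate n false <:+: kociumakaWord k := by
  refine ⟨List.replicate k false ++ [true] ++ List.replicate k false ++ [true],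
    List.replicate (2 * k - n) false, ?_⟩
  unfold kociumakaWord
  rw [List.append_assoc _ (List.replicate n false), List.replicate_append_replicate]
  congr 2; omega

/-- For every `k ≥ 1`, the binary word `aᵏ b aᵏ b a²ᵏ` (of length `4k+2`)
contains at least `k + (⌊k/2⌋+1)² + (k+1)·⌈k/2⌉` distinct abelian square
factors. -/
theorem kociumakaWord_distinct_abelian_squares (k : ℕ) (hk : 1 ≤ k) :
    k + (k / 2 + 1) ^ 2 + (k + 1) * ((k + 1) / 2) ≤
      {u : List Bool | AbelianSquare u ∧ u <:+: kociumakaWord k}.ncard := by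
  classical
  have hfin : {u : List Bool | AbelianSquare u ∧ u <:+: kociumakaWord k}.Finite := by
    refine ((kociumakaWord k).sublists.toFinset.finite_toSet).subset ?_
    intro u hu
    simpa using hu.2.sublist
  let A : Finset (List Bool) :=
    (Finset.range k).image fun t => List.replicate (2 * (t + 1)) false
  let I : Finset (Σ _ : ℕ, ℕ) :=
    (Finset.range (k + 1)).sigma fun i => Finset.range ((i + k) / 2 + 1)
  let B : Finset (List Bool) := I.image fun p => twoB k p.1 (p.1 + k - 2 * p.2)
  have hA : A.card = k := by
    rw [Finset.card_image_of_injective, Finset.card_range]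
    intro s t h
    have := congrArg List.length h
    simp at this
    omega
  have hB : B.card = (k / 2 + 1) ^ 2 + (k + 1) * ((k + 1) / 2) := by
    rw [Finset.card_image_of_injOn, Finset.card_sigma, ← sum_formula]
    · simp
    · rintro ⟨i, s⟩ hp ⟨i', s'⟩ hq h
      simp [I] at hp hq
      have h1 := congrArg (List.idxOf true) h
      have h2 := congrArg List.length h
      simp only [twoB_idxOf, twoB_length] at h1 h2
      subst h1
      have : s = s' := by omega
      rw [this]
  have hdis : Disjoint A B := by
    rw [Finset.disjoint_left]
    intro u hu hv
    simp only [A, B, Finset.mem_image] at hu hv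
    obtain ⟨t, _, rfl⟩ := hu
    obtain ⟨p, _, hp⟩ := hv
    have := congrArg (List.count true) hp
    rw [twoB_count] at this
    simp [List.count_replicate] at this
  have hsub : ((A ∪ B : Finset (List Bool)) : Set (List Bool)) ⊆
      {u : List Bool | AbelianSquare u ∧ u <:+: kociumakaWord k} := by
    intro u hu
    rcases Finset.mem_union.1 (Finset.mem_coe.1 hu) with h | h
    · obtain ⟨t, ht, rfl⟩ := Finset.mem_image.1 h
      have := Finset.mem_range.1 ht
      exact ⟨rep_square t, rep_infix k _ (by omega)⟩
    · obtain ⟨⟨i, s⟩, hp, rfl⟩ := Finset.mem_image.1 h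
      simp [I] at hp
      exact ⟨twoB_square k i s (by omega) (by omega), twoB_infix k i _ (by omega) (by dsimp only; omega)⟩
  have hle := Set.ncard_le_ncard hsub hfin
  rw [Set.ncard_coe_finset, Finset.card_union_of_disjoint hdis, hA, hB] at hle
  omega
end

section
/- Let w₁ = ab and, for k > 1, wₖ = wₖ₋₁ aᵏ bᵏ (so |wₖ| = k(k+1)). There exists a constant c > 0 such that for all k ≥ 2, the binary word wₖ contains at least c · |wₖ|^{3/2} / log |wₖ| non-equivalent abelian squares. Consequently, the maximum number of non-equivalent abelian squares in a binary word of length n is Ω(n^{3/2}/log n). -/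
/-- The set of Parikh vectors `(|u|_a, |u|_b)` of halves `u` of abelian squares
`uv` occurring as factors of the binary word `w`; its cardinality is the number
of non-equivalent abelian squares in `w` (with `a = false`, `b = true`). -/
def nonEquivAbelianSquares (w : List Bool) : Set (ℕ × ℕ) :=
  {p | ∃ u v : List Bool, u ≠ [] ∧ u.length = v.length ∧ ParikhEq u v ∧
    (u ++ v) <:+: w ∧ p = (u.count false, u.count true)}

/-- The words `w₁ = ab`, `wₖ = wₖ₋₁ aᵏ bᵏ` for `k > 1` (with `a = false`,
`b = true`). -/
def kucherovWord : ℕ → List Bool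
  | 0 => []
  | 1 => [false, true]
  | (k + 2) => kucherovWord (k + 1) ++ List.replicate (k + 2) false ++
      List.replicate (k + 2) true

lemma kw_succ (k : ℕ) : kucherovWord (k + 1) = kucherovWord k ++ List.replicate (k + 1) false ++
    List.replicate (k + 1) true := by
  cases k with
  | zero => rfl
  | succ k => rfl

/-- Triangular numbers. -/
def triNum : ℕ → ℕ
  | 0 => 0
  | (k + 1) => triNum k + (k + 1)

lemma two_triNum (k : ℕ) : 2 * triNum k = k * (k + 1) := by
  induction k with
  | zero => rfl
  | succ k ih => simp only [triNum]; linarith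

lemma kw_count (k : ℕ) (x : Bool) : (kucherovWord k).count x = triNum k := by
  induction k with
  | zero => rfl
  | succ k ih =>
    rw [kw_succ]
    cases x <;> simp [List.count_replicate, ih, triNum]

lemma kw_length (k : ℕ) : (kucherovWord k).length = k * (k + 1) := by
  induction k with
  | zero => rfl
  | succ k ih =>
    rw [kw_succ]
    simp [ih]; ring

lemma kw_isPre {i k : ℕ} (h : i ≤ k) : kucherovWord i <+: kucherovWord k := by
  induction k, h using Nat.le_induction with
  | base => exact List.prefix_rfl
  | succ k _ ih =>
    refine ih.trans ?_
    rw [kw_succ, List.append_assoc]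
    exact List.prefix_append _ _

lemma replicate_isPre {s n : ℕ} (h : s ≤ n) (x : Bool) :
    List.replicate s x <+: List.replicate n x := by
  obtain ⟨d, rfl⟩ := Nat.exists_eq_add_of_le h
  rw [List.replicate_add]
  exact List.prefix_append _ _

/-- Horizontal points of the lattice path. -/
lemma point_h {i k s : ℕ} (h : i + 1 ≤ k) (hs : s ≤ i + 1) :
    ∃ X, X <+: kucherovWord k ∧ X.count false = triNum i + s ∧ X.count true = triNum i := by
  refine ⟨kucherovWord i ++ List.replicate s false, ?_, ?_, ?_⟩
  · refine List.IsPrefix.trans ?_ (kw_isPre h)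
    rw [kw_succ, List.append_assoc, List.prefix_append_right_inj]
    exact (replicate_isPre hs false).trans (List.prefix_append _ _)
  · simp [kw_count]
  · simp [kw_count, List.count_replicate]

/-- Vertical points of the lattice path. -/
lemma point_v {i k s : ℕ} (h : i + 1 ≤ k) (hs : s ≤ i + 1) :
    ∃ X, X <+: kucherovWord k ∧ X.count false = triNum (i + 1) ∧ X.count true = triNum i + s := by
  refine ⟨kucherovWord i ++ List.replicate (i + 1) false ++ List.replicate s true, ?_, ?_, ?_⟩
  · refine List.IsPrefix.trans ?_ (kw_isPre h)
    rw [kw_succ, List.prefix_append_right_inj]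
    exact replicate_isPre hs true
  · simp [kw_count, List.count_replicate, triNum]
  · simp [kw_count, List.count_replicate]

lemma length_eq_counts (u : List Bool) : u.length = u.count false + u.count true := by
  rw [add_comm, List.count_true_add_count_false]

lemma mem_of_points {w X Y Z : List Bool} (hX : X <+: w) (hY : Y <+: w) (hZ : Z <+: w) {a b : ℕ}
    (hab : 0 < a + b)
    (h1 : Y.count false = X.count false + a) (h2 : Y.count true = X.count true + b)
    (h3 : Z.count false = Y.count false + a) (h4 : Z.count true = Y.count true + b) :
    (a, b) ∈ nonEquivAbelianSquares w := by
  have lX := length_eq_counts X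
  have lY := length_eq_counts Y
  have lZ := length_eq_counts Z
  obtain ⟨u, rfl⟩ := List.prefix_of_prefix_length_le hX hY (by omega)
  obtain ⟨v, rfl⟩ := List.prefix_of_prefix_length_le hY hZ (by omega)
  obtain ⟨t, rfl⟩ := hZ
  simp only [List.count_append] at *
  have lu := length_eq_counts u
  have lv := length_eq_counts v
  refine ⟨u, v, ?_, by omega, ?_, ⟨X, t, by simp⟩, ?_⟩
  · rintro rfl
    simp at *
    omega
  · intro x
    cases x <;> omega
  · ext <;> simp <;> omega

lemma nonEquiv_finite (w : List Bool) : (nonEquivAbelianSquares w).Finite := by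
  refine ((Set.finite_Iic w.length).prod (Set.finite_Iic w.length)).subset ?_
  rintro p ⟨u, v, -, -, -, h, rfl⟩
  have h1 := h.length_le
  rw [List.length_append] at h1
  have h2 := List.count_le_length (a := false) (l := u)
  have h3 := List.count_le_length (a := true) (l := u)
  simp only [Set.mem_prod, Set.mem_Iic]
  omega

lemma nonEquiv_mono {w w' : List Bool} (h : w <:+: w') :
    nonEquivAbelianSquares w ⊆ nonEquivAbelianSquares w' := by
  rintro p ⟨u, v, h1, h2, h3, h4, h5⟩
  exact ⟨u, v, h1, h2, h3, h4.trans h, h5⟩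

lemma tri_bracket (z : ℕ) (hz : 0 < z) : ∃ l, triNum l < z ∧ z ≤ triNum (l + 1) := by
  induction z, hz using Nat.le_induction with
  | base => exact ⟨0, by simp [triNum]⟩
  | succ z _ ih =>
    obtain ⟨l, h1, h2⟩ := ih
    rcases Nat.lt_or_ge z (triNum (l + 1)) with h | h
    · exact ⟨l, by omega, by omega⟩
    · exact ⟨l + 1, by omega, by simp only [triNum] at *; omega⟩

lemma aux_ineq {l j : ℕ} (h : 3 * j + 1 ≤ 2 * l) (h' : l * (l + 1) < 2 * (j * (j + 1))) : False := by
  have h1 := Nat.mul_le_mul h (show 3 * j + 3 ≤ 2 * l + 2 by omega)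
  nlinarith

lemma key (n c μ k : ℕ) (hn : 2 ≤ n) (hc : 2 * c + 1 ≤ n) (h1 : 2 * n ≤ μ) (h2 : μ ≤ 3 * n)
    (hk : 6 * n ≤ k) :
    ∃ a₀, ∀ σ, 2 * σ + 1 ≤ n → σ ≤ a₀ ∧
      (a₀ - σ, (2 * c + 1) * μ) ∈ nonEquivAbelianSquares (kucherovWord k) := by
  obtain ⟨i, hi⟩ : ∃ i, μ = i + 1 + c := ⟨μ - 1 - c, by omega⟩
  obtain ⟨j, hj⟩ : ∃ j, j = μ + c := ⟨_, rfl⟩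
  have Ti := two_triNum i
  have Tj := two_triNum j
  have hD : triNum j = triNum i + (2 * c + 1) * μ := by
    subst hj; subst hi; nlinarith
  set D := (2 * c + 1) * μ with hDdef
  have hDn : n ≤ D := by rw [hDdef]; nlinarith
  obtain ⟨l, hl1, hl2⟩ := tri_bracket (triNum i + 2 * D) (by omega)
  have Tl := two_triNum l
  have hTl1 : triNum (l + 1) = triNum l + (l + 1) := rfl
  have hlj : 2 * l ≤ 3 * j := by
    by_contra hcon
    have h3 : l * (l + 1) < 2 * (j * (j + 1)) := by omega
    exact aux_ineq (by omega) h3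
  obtain ⟨d, hd⟩ := Nat.exists_eq_add_of_le hl2
  obtain ⟨e, f, he, hf⟩ : ∃ e f, e ≤ 1 ∧ d + e = 2 * f := ⟨d % 2, (d + d % 2) / 2, by omega, by omega⟩
  refine ⟨D + f - e, fun σ hσ => ⟨by omega, ?_⟩⟩
  obtain ⟨X, hX, hX1, hX2⟩ := point_h (i := i) (k := k) (s := 2 * σ + e) (by omega) (by omega)
  obtain ⟨Y, hY, hY1, hY2⟩ := point_h (i := j) (k := k) (s := σ + f) (by omega) (by omega)
  obtain ⟨Z, hZ, hZ1, hZ2⟩ := point_v (i := l) (k := k) (s := triNum i + 2 * D - triNum l)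
    (by omega) (by omega)
  exact mem_of_points hX hY hZ (by omega) (by omega) (by omega) (by omega) (by omega)

lemma ncard_ge (w : List Bool) (E : Finset ℕ) (H : ℕ)
    (h : ∀ D ∈ E, ∃ a₀, ∀ σ, σ < H → σ ≤ a₀ ∧ (a₀ - σ, D) ∈ nonEquivAbelianSquares w) :
    E.card * H ≤ (nonEquivAbelianSquares w).ncard := by
  choose! a ha using h
  have : Set.InjOn (fun x : ℕ × ℕ => (a x.1 - x.2, x.1)) (E ×ˢ Finset.range H : Finset (ℕ × ℕ)) := by
    rintro ⟨D, σ⟩ h1 ⟨D', σ'⟩ h2 h3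
    simp only [Finset.coe_product, Set.mem_prod, Finset.mem_coe, Finset.mem_range, Prod.mk.injEq]
      at h1 h2 h3
    obtain ⟨h3, rfl⟩ := h3
    have := (ha D h1.1 σ h1.2).1
    have := (ha D h1.1 σ' h2.2).1
    simp; omega
  have hc := Finset.card_image_of_injOn this
  rw [Finset.card_product, Finset.card_range] at hc
  rw [← hc, ← Set.ncard_coe_finset]
  refine Set.ncard_le_ncard ?_ (nonEquiv_finite w)
  intro y hy
  simp only [Finset.coe_image, Finset.coe_product, Set.mem_image, Set.mem_prod, Finset.mem_coe,
    Finset.mem_range, Prod.exists] at hy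
  obtain ⟨D, σ, ⟨h1, h2⟩, rfl⟩ := hy
  exact (ha D h1 σ h2).2

/-- Primes in `(q, 8q]`. -/
def bigPrimes (q : ℕ) : Finset ℕ := (Finset.Ioc q (8 * q)).filter Nat.Prime

lemma products_card (q : ℕ) (hq : 192 < q) :
    (bigPrimes q).card * (8 * q) ≤ 2 *
      (((bigPrimes q) ×ˢ Finset.Ico (16 * q) (24 * q)).image (fun x : ℕ × ℕ => x.1 * x.2)).card := by
  have h := Finset.card_le_mul_card_image (f := fun x : ℕ × ℕ => x.1 * x.2)
    ((bigPrimes q) ×ˢ Finset.Ico (16 * q) (24 * q)) 2 ?_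
  · rw [Finset.card_product, Nat.card_Ico] at h
    convert h using 2
    omega
  · intro N hN
    by_contra! hcon
    rw [Finset.two_lt_card] at hcon
    obtain ⟨⟨a, a'⟩, ha, ⟨b, b'⟩, hb, ⟨c, c'⟩, hc, hab, hac, hbc⟩ := hcon
    simp only [Finset.mem_filter, Finset.mem_product, Finset.mem_Ico, bigPrimes, Finset.mem_Ioc]
      at ha hb hc
    obtain ⟨⟨⟨⟨ha1, ha2⟩, ha3⟩, ha4, ha5⟩, ha6⟩ := ha
    obtain ⟨⟨⟨⟨hb1, hb2⟩, hb3⟩, hb4, hb5⟩, hb6⟩ := hb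
    obtain ⟨⟨⟨⟨hc1, hc2⟩, hc3⟩, hc4, hc5⟩, hc6⟩ := hc
    have hne : ∀ x x' y y' : ℕ, q < x → x * x' = N → y * y' = N → (x, x') ≠ (y, y') → x ≠ y := by
      rintro x x' y y' h0 h1 h2 h3 rfl
      apply h3
      rw [Nat.eq_of_mul_eq_mul_left (by omega) (h1.trans h2.symm)]
    have nab := (Nat.coprime_primes ha3 hb3).2 (hne _ _ _ _ ha1 ha6 hb6 hab)
    have nac := (Nat.coprime_primes ha3 hc3).2 (hne _ _ _ _ ha1 ha6 hc6 hac)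
    have nbc := (Nat.coprime_primes hb3 hc3).2 (hne _ _ _ _ hb1 hb6 hc6 hbc)
    have hdvd : a * b * c ∣ N :=
      (Nat.Coprime.mul_left nac nbc).mul_dvd_of_dvd_of_dvd
        (nab.mul_dvd_of_dvd_of_dvd ⟨_, ha6.symm⟩ ⟨_, hb6.symm⟩) ⟨_, hc6.symm⟩
    have hN0 : 0 < N := by rw [← ha6]; exact Nat.mul_pos (by omega) (by omega)
    have hle := Nat.le_of_dvd hN0 hdvd
    have h3 : N ≤ 8 * q * (24 * q) := by rw [← ha6]; exact Nat.mul_le_mul ha2 (by omega)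
    have h4 : q * q * q ≤ a * b * c :=
      Nat.mul_le_mul (Nat.mul_le_mul ha1.le hb1.le) hc1.le
    have h5 : 193 * (q * q) ≤ q * (q * q) := Nat.mul_le_mul_right _ hq
    nlinarith [Nat.mul_pos (show 0 < q by omega) (show 0 < q by omega)]

lemma ncard_ge_primes (q k : ℕ) (hq : 192 < q) (hk : 48 * q ≤ k) :
    (bigPrimes q).card * (16 * q ^ 2) ≤ (nonEquivAbelianSquares (kucherovWord k)).ncard := by
  have h1 := products_card q hq
  have h2 := ncard_ge (kucherovWord k)
    (((bigPrimes q) ×ˢ Finset.Ico (16 * q) (24 * q)).image (fun x : ℕ × ℕ => x.1 * x.2)) (4 * q) ?_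
  · nlinarith
  · intro D hD
    simp only [Finset.mem_image, Finset.mem_product, Finset.mem_Ico, bigPrimes, Finset.mem_Ioc,
      Finset.mem_filter, Prod.exists] at hD
    obtain ⟨p, μ, ⟨⟨⟨hp1, hp2⟩, hp⟩, hμ1, hμ2⟩, rfl⟩ := hD
    obtain ⟨c, rfl⟩ := hp.odd_of_ne_two (by omega)
    obtain ⟨a, ha⟩ := key (8 * q) c μ k (by omega) hp2 (by omega) (by omega) (by omega)
    exact ⟨a, fun σ hσ => ha σ (by omega)⟩

lemma primes_lower (q : ℕ) (hq : 100 ^ 4 ≤ q) :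
    (q : ℝ) ≤ (bigPrimes q).card * Real.log (8 * q) := by
  have h1 := Chebyshev.theta_ge (8 * q)
  have h2 := Chebyshev.theta_le_log4_mul_x (x := q) (by positivity)
  have hq' : (100 : ℝ) ^ 4 ≤ q := by exact_mod_cast hq
  have h3 : Chebyshev.theta ((8 * q : ℕ) : ℝ) - Chebyshev.theta q ≤
      (bigPrimes q).card * Real.log (8 * q) := by
    have hsum : Chebyshev.theta ((8 * q : ℕ) : ℝ) - Chebyshev.theta q =
        ∑ p ∈ bigPrimes q, Real.log p := by
      unfold Chebyshev.theta bigPrimes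
      rw [Nat.floor_natCast, Nat.floor_natCast, sub_eq_iff_eq_add, Finset.sum_filter,
        Finset.sum_filter, Finset.sum_filter, add_comm]
      exact (Finset.sum_Ioc_consecutive _ (Nat.zero_le q) (by omega)).symm
    rw [hsum, ← nsmul_eq_mul]
    refine Finset.sum_le_card_nsmul _ _ _ ?_
    intro p hp
    simp only [bigPrimes, Finset.mem_filter, Finset.mem_Ioc] at hp
    apply Real.log_le_log
    · exact_mod_cast hp.2.pos
    · exact_mod_cast hp.1.2
  have hl4 : Real.log 4 = 2 * Real.log 2 := by
    rw [show (4 : ℝ) = 2 ^ 2 by norm_num, Real.log_pow]; norm_num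
  have hl2 := Real.log_two_gt_d9
  have hl2' := Real.log_two_lt_d9
  push_cast at h1 h3
  set y : ℝ := 8 * (q : ℝ) with hy
  have hy0 : 0 < y := by positivity
  set r : ℝ := y ^ ((1 : ℝ) / 4) with hr
  have hr0 : 0 < r := by positivity
  have hr4 : r ^ 4 = y := by
    rw [hr, ← Real.rpow_natCast, ← Real.rpow_mul hy0.le]; norm_num
  have hr100 : 100 ≤ r := by
    by_contra! hcon
    have : r ^ 4 < 100 ^ 4 := pow_lt_pow_left₀ hcon hr0.le (by norm_num)
    linarith
  have hsq : √y = r ^ 2 := by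
    rw [Real.sqrt_eq_iff_mul_self_eq hy0.le (by positivity), ← hr4]; ring
  have hlog : Real.log y ≤ 4 * r := by
    have := Real.log_le_rpow_div hy0.le (show (0 : ℝ) < 1 / 4 by norm_num)
    rw [← hr] at this
    linarith
  have hlog1 : Real.log (y + 1) ≤ 4 * r + 1 := by
    have : Real.log (y + 1) ≤ Real.log (2 * y) := Real.log_le_log (by linarith) (by linarith)
    rw [Real.log_mul (by norm_num) hy0.ne'] at this
    linarith
  have hm : 2 * √y * Real.log y ≤ 8 * r ^ 3 := by
    rw [hsq]
    have := mul_le_mul_of_nonneg_left hlog (show 0 ≤ 2 * r ^ 2 by positivity)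
    nlinarith
  have h5 : 8 * r ^ 3 + 4 * r + 1 ≤ y * (9 / 100) := by
    rw [← hr4]
    have : 100 * r ^ 3 ≤ r * r ^ 3 := mul_le_mul_of_nonneg_right hr100 (by positivity)
    have h6 : 100 * 100 * r ≤ r ^ 3 := by nlinarith [mul_le_mul hr100 hr100 (by norm_num) hr0.le]
    nlinarith
  rw [hl4] at h2
  have h6 : (69 / 100 : ℝ) * q ≤ Real.log 2 * q :=
    mul_le_mul_of_nonneg_right (by linarith) (by positivity)
  have h7 : y * Real.log 2 = 8 * (Real.log 2 * q) := by rw [hy]; ring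
  linarith

lemma core_large (k : ℕ) (hk : 48 * 100 ^ 4 ≤ k) :
    (1 / 96 ^ 3 : ℝ) * k ^ 3 / Real.log k ≤
      ((nonEquivAbelianSquares (kucherovWord k)).ncard : ℝ) := by
  obtain ⟨q, hq⟩ : ∃ q, q = k / 48 := ⟨_, rfl⟩
  have h1 := ncard_ge_primes q k (by omega) (by omega)
  have h2 := primes_lower q (by omega)
  have hkq : (k : ℝ) ≤ 96 * q := by exact_mod_cast (show k ≤ 96 * q by omega)
  have hkq2 : (8 * q : ℝ) ≤ k := by exact_mod_cast (show 8 * q ≤ k by omega)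
  have hq0 : (1 : ℝ) ≤ q := by exact_mod_cast (show 1 ≤ q by omega)
  have hlogk : Real.log (8 * q) ≤ Real.log k := Real.log_le_log (by linarith) hkq2
  have hlog0 : 0 < Real.log k := Real.log_pos (by linarith)
  rw [div_le_iff₀ hlog0]
  have h1' : ((bigPrimes q).card : ℝ) * (16 * q ^ 2) ≤
      ((nonEquivAbelianSquares (kucherovWord k)).ncard : ℝ) := by exact_mod_cast h1
  have h3 : (q : ℝ) ≤ (bigPrimes q).card * Real.log k :=
    h2.trans (mul_le_mul_of_nonneg_left hlogk (by positivity))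
  have h4 : (k : ℝ) ^ 3 ≤ (96 * q) ^ 3 := pow_le_pow_left₀ (by positivity) hkq 3
  have h5 : (1 / 96 ^ 3 : ℝ) * k ^ 3 ≤ q ^ 3 := by
    rw [mul_pow] at h4; linarith
  calc (1 / 96 ^ 3 : ℝ) * k ^ 3 ≤ q ^ 3 := h5
    _ = q * q ^ 2 := by ring
    _ ≤ ((bigPrimes q).card * Real.log k) * q ^ 2 := by gcongr
    _ ≤ ((bigPrimes q).card * Real.log k) * (16 * q ^ 2) := by
        apply mul_le_mul_of_nonneg_left _ (by positivity)
        nlinarith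
    _ = ((bigPrimes q).card * (16 * q ^ 2)) * Real.log k := by ring
    _ ≤ _ := by gcongr

lemma ncard_pos (k : ℕ) (hk : 2 ≤ k) :
    (1 : ℝ) ≤ ((nonEquivAbelianSquares (kucherovWord k)).ncard : ℝ) := by
  have : 0 < (nonEquivAbelianSquares (kucherovWord k)).ncard := by
    rw [Set.ncard_pos (nonEquiv_finite _)]
    refine ⟨(1, 0), nonEquiv_mono (kw_isPre hk).isInfix ?_⟩
    exact ⟨[false], [false], by simp, rfl, fun _ => rfl, ⟨[false, true], [true, true], rfl⟩, rfl⟩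
  exact_mod_cast this

lemma core : ∃ c : ℝ, 0 < c ∧ ∀ k : ℕ, 2 ≤ k →
    c * (k : ℝ) ^ 3 / Real.log k ≤ ((nonEquivAbelianSquares (kucherovWord k)).ncard : ℝ) := by
  have hK : (0 : ℝ) < (48 * 100 ^ 4) ^ 3 := by positivity
  refine ⟨min (1 / 96 ^ 3) (Real.log 2 / (48 * 100 ^ 4) ^ 3), ?_, fun k hk => ?_⟩
  · exact lt_min (by positivity) (div_pos (Real.log_pos (by norm_num)) hK)
  · have hk' : (2 : ℝ) ≤ k := by exact_mod_cast hk
    have hlog : Real.log 2 ≤ Real.log k := Real.log_le_log (by norm_num) hk'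
    have hlog2 : 0 < Real.log 2 := Real.log_pos (by norm_num)
    have hlog0 : 0 < Real.log k := by linarith
    rcases Nat.lt_or_ge k (48 * 100 ^ 4) with h | h
    · refine le_trans ?_ (ncard_pos k hk)
      rw [div_le_one hlog0]
      refine le_trans ?_ hlog
      have hkK : (k : ℝ) ≤ 48 * 100 ^ 4 := by exact_mod_cast h.le
      have : (k : ℝ) ^ 3 ≤ (48 * 100 ^ 4) ^ 3 := pow_le_pow_left₀ (by positivity) hkK 3
      calc _ ≤ Real.log 2 / (48 * 100 ^ 4) ^ 3 * (48 * 100 ^ 4) ^ 3 :=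
            mul_le_mul (min_le_right _ _) this (by positivity) (by positivity)
        _ = Real.log 2 := div_mul_cancel₀ _ hK.ne'
    · refine le_trans ?_ (core_large k h)
      gcongr
      exact min_le_left _ _

/-- Transfer of the bound to a word of any length comparable to `k^2`. -/
lemma transfer {c : ℝ} (hc : 0 < c) {k n : ℕ} (hk : 2 ≤ k) (h1 : k ≤ n) (h2 : n ≤ 4 * k ^ 2) :
    c / 8 * (n : ℝ) ^ ((3 : ℝ) / 2) / Real.log n ≤ c * (k : ℝ) ^ 3 / Real.log k := by
  have hk' : (2 : ℝ) ≤ k := by exact_mod_cast hk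
  have h1' : (k : ℝ) ≤ n := by exact_mod_cast h1
  have h2' : (n : ℝ) ≤ (2 * k) ^ 2 := by
    have : (n : ℝ) ≤ 4 * k ^ 2 := by exact_mod_cast h2
    linarith
  have hlog0 : 0 < Real.log k := Real.log_pos (by linarith)
  have hlog : Real.log k ≤ Real.log n := Real.log_le_log (by linarith) h1'
  have hp : (n : ℝ) ^ ((3 : ℝ) / 2) ≤ 8 * k ^ 3 := by
    calc (n : ℝ) ^ ((3 : ℝ) / 2) ≤ (((2 * k : ℝ)) ^ 2) ^ ((3 : ℝ) / 2) :=
          Real.rpow_le_rpow (by positivity) h2' (by norm_num)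
      _ = (2 * k : ℝ) ^ 3 := by
          rw [← Real.rpow_natCast, ← Real.rpow_natCast, ← Real.rpow_mul (by positivity)]
          norm_num
      _ = _ := by ring
  apply div_le_div₀ (by positivity) _ hlog0 hlog
  nlinarith

/-- There is a constant `c > 0` such that for all `k ≥ 2` the word `wₖ` contains
at least `c·|wₖ|^{3/2}/log |wₖ|` non-equivalent abelian squares; consequently the
maximum number of non-equivalent abelian squares in a binary word of length `n`
is `Ω(n^{3/2}/log n)`. -/
theorem kucherovWord_nonequiv_abelian_squares :
    (∃ c : ℝ, 0 < c ∧ ∀ k : ℕ, 2 ≤ k →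
      c * ((kucherovWord k).length : ℝ) ^ ((3 : ℝ) / 2) /
          Real.log ((kucherovWord k).length) ≤
        ((nonEquivAbelianSquares (kucherovWord k)).ncard : ℝ)) ∧
    (∃ c : ℝ, 0 < c ∧ ∃ N : ℕ, ∀ n : ℕ, N ≤ n → ∃ w : List Bool, w.length = n ∧
      c * (n : ℝ) ^ ((3 : ℝ) / 2) / Real.log n ≤
        ((nonEquivAbelianSquares w).ncard : ℝ)) := by
  obtain ⟨c, hc, h⟩ := core
  refine ⟨⟨c / 8, by positivity, fun k hk => ?_⟩, c / 8, by positivity, 6, fun n hn => ?_⟩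
  · refine le_trans ?_ (h k hk)
    rw [kw_length]
    exact transfer hc hk (by nlinarith) (by nlinarith)
  · obtain ⟨k, hk2, hk, hk'⟩ : ∃ k, 2 ≤ k ∧ k * (k + 1) ≤ n ∧ n < (k + 1) * (k + 2) := by
      induction n, hn using Nat.le_induction with
      | base => exact ⟨2, by norm_num⟩
      | succ n _ ih =>
        obtain ⟨k, h0, h1, h2⟩ := ih
        rcases Nat.lt_or_ge (n + 1) ((k + 1) * (k + 2)) with h | h
        · exact ⟨k, h0, by omega, h⟩
        · exact ⟨k + 1, by omega, h, by nlinarith⟩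
    refine ⟨kucherovWord k ++ List.replicate (n - k * (k + 1)) false, ?_, ?_⟩
    · rw [List.length_append, kw_length, List.length_replicate]; omega
    · refine (transfer hc hk2 (by nlinarith) (by nlinarith)).trans ((h k hk2).trans ?_)
      have := Set.ncard_le_ncard (nonEquiv_mono (List.prefix_append (kucherovWord k)
        (List.replicate (n - k * (k + 1)) false)).isInfix) (nonEquiv_finite _)
      exact_mod_cast this
end

section
/- There exists an infinite word over a three-letter alphabet that contains no abelian cube as a factor (Dekking's theorem). -/
/-- A word is an abelian cube if it is the concatenation of three nonempty
pairwise Parikh-equivalent words of the same length. -/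
def AbelianCube {α : Type*} [DecidableEq α] (w : List α) : Prop :=
  ∃ u₁ u₂ u₃ : List α, u₁ ≠ [] ∧ u₁.length = u₂.length ∧ u₂.length = u₃.length ∧
    ParikhEq u₁ u₂ ∧ ParikhEq u₂ u₃ ∧ w = u₁ ++ u₂ ++ u₃

/-- Dekking's morphism `0 ↦ 0012`, `1 ↦ 112`, `2 ↦ 022` on letters. -/
def dekLetter : Fin 3 → List (Fin 3)
  | 0 => [0, 0, 1, 2]
  | 1 => [1, 1, 2]
  | 2 => [0, 2, 2]

/-- Dekking's morphism on words. -/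
def dek (v : List (Fin 3)) : List (Fin 3) := v.flatMap dekLetter

/-- Number of occurrences of `x` in the prefix of length `p`. -/
def prefCount (v : List (Fin 3)) (x : Fin 3) (p : ℕ) : ℤ := ((v.take p).count x : ℤ)

/-- Abelian-cube-freeness in terms of cut positions. -/
def CutFree (v : List (Fin 3)) : Prop :=
  ∀ p q r s : ℕ, p < q → q < r → r < s → s ≤ v.length →
    (∀ x, prefCount v x q - prefCount v x p = prefCount v x r - prefCount v x q) →
    (∀ x, prefCount v x r - prefCount v x q = prefCount v x s - prefCount v x r) → False

theorem prefCount_sum (v : List (Fin 3)) (p : ℕ) (hp : p ≤ v.length) :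
    prefCount v 0 p + prefCount v 1 p + prefCount v 2 p = p := by
  have key : ∀ l : List (Fin 3), l.count 0 + l.count 1 + l.count 2 = l.length := by
    intro l
    induction l with
    | nil => simp
    | cons a l ih =>
      fin_cases a <;> simp [List.count_cons] <;> omega
  have h := key (v.take p)
  rw [List.length_take, min_eq_left hp] at h
  unfold prefCount
  exact_mod_cast h

theorem prefCount_mono (v : List (Fin 3)) (x : Fin 3) {p q : ℕ} (h : p ≤ q) :
    prefCount v x p ≤ prefCount v x q := by
  unfold prefCount
  exact_mod_cast ((List.take_prefix_take_left h).sublist.count_le x)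

/-- Counts of a prefix of `dek v` are the image of the counts of a prefix of `v`, up to one of
four correction vectors. -/
def Dec (A B C a b c : ℤ) : Prop :=
    (A = 2 * a + c ∧ B = a + 2 * b ∧ C = a + b + 2 * c) ∨
    (A = 2 * a + c + 1 ∧ B = a + 2 * b ∧ C = a + b + 2 * c) ∨
    (A = 2 * a + c ∧ B = a + 2 * b - 1 ∧ C = a + b + 2 * c - 1) ∨
    (A = 2 * a + c ∧ B = a + 2 * b ∧ C = a + b + 2 * c - 1)

theorem prefCount_zero (v : List (Fin 3)) (x : Fin 3) : prefCount v x 0 = 0 := by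
  simp [prefCount]

theorem prefCount_cons (a : Fin 3) (v : List (Fin 3)) (x : Fin 3) (k : ℕ) :
    prefCount (a :: v) x (k + 1) = prefCount v x k + if a = x then 1 else 0 := by
  simp only [prefCount, List.take_succ_cons, List.count_cons, beq_iff_eq]
  push_cast
  rfl

theorem dec_exists (v : List (Fin 3)) : ∀ p : ℕ, p ≤ (dek v).length → ∃ k ≤ v.length,
    Dec (prefCount (dek v) 0 p) (prefCount (dek v) 1 p) (prefCount (dek v) 2 p)
      (prefCount v 0 k) (prefCount v 1 k) (prefCount v 2 k) := by
  induction v with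
  | nil =>
    intro p hp
    exact ⟨0, le_rfl, by simp [dek, prefCount, Dec]⟩
  | cons a v ih =>
    intro p hp
    have hd : dek (a :: v) = dekLetter a ++ dek v := by simp [dek]
    rw [hd] at hp ⊢
    fin_cases a
    · simp only [dekLetter, List.cons_append, List.nil_append, List.length_cons] at hp ⊢
      match p, hp with
      | 0, _ => exact ⟨0, by simp, by simp [prefCount_zero, Dec]⟩
      | 1, _ => exact ⟨0, by simp, by simp [prefCount_cons, prefCount_zero, Dec]⟩
      | 2, _ => exact ⟨1, by simp, by simp [prefCount_cons _ _ _ 0, prefCount_cons _ _ _ 1, prefCount_zero, Dec]⟩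
      | 3, _ => exact ⟨1, by simp, by simp [prefCount_cons _ _ _ 0, prefCount_cons _ _ _ 1, prefCount_cons _ _ _ 2, prefCount_zero, Dec]⟩
      | p + 4, hp =>
        obtain ⟨k, hk, h⟩ := ih p (by omega)
        refine ⟨k + 1, by omega, ?_⟩
        simp [prefCount_cons, Dec] at h ⊢
        omega
    · simp only [dekLetter, List.cons_append, List.nil_append, List.length_cons] at hp ⊢
      match p, hp with
      | 0, _ => exact ⟨0, by simp, by simp [prefCount_zero, Dec]⟩
      | 1, _ => exact ⟨1, by simp, by simp [prefCount_cons _ _ _ 0, prefCount_zero, Dec]⟩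
      | 2, _ => exact ⟨1, by simp, by simp [prefCount_cons _ _ _ 0, prefCount_cons _ _ _ 1, prefCount_zero, Dec]⟩
      | p + 3, hp =>
        obtain ⟨k, hk, h⟩ := ih p (by omega)
        refine ⟨k + 1, by omega, ?_⟩
        simp [prefCount_cons, Dec] at h ⊢
        omega
    · simp only [dekLetter, List.cons_append, List.nil_append, List.length_cons] at hp ⊢
      match p, hp with
      | 0, _ => exact ⟨0, by simp, by simp [prefCount_zero, Dec]⟩
      | 1, _ => exact ⟨0, by simp, by simp [prefCount_cons _ _ _ 0, prefCount_zero, Dec]⟩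
      | 2, _ => exact ⟨1, by simp, by simp [prefCount_cons _ _ _ 0, prefCount_cons _ _ _ 1, prefCount_zero, Dec]⟩
      | p + 3, hp =>
        obtain ⟨k, hk, h⟩ := ih p (by omega)
        refine ⟨k + 1, by omega, ?_⟩
        simp [prefCount_cons, Dec] at h ⊢
        omega

/-- The correction vectors, indexed by `0, 4, 1, 2` modulo 7. -/
theorem Dec.elim {A B C a b c : ℤ} (h : Dec A B C a b c) : ∃ α β γ : ℤ,
    A = 2 * a + c + α ∧ B = a + 2 * b + β ∧ C = a + b + 2 * c + γ ∧
    ((α = 0 ∧ β = 0 ∧ γ = 0) ∨ (α = 1 ∧ β = 0 ∧ γ = 0) ∨ (α = 0 ∧ β = -1 ∧ γ = -1) ∨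
      (α = 0 ∧ β = 0 ∧ γ = -1)) := by
  rcases h with h | h | h | h
  · exact ⟨0, 0, 0, by omega⟩
  · exact ⟨1, 0, 0, by omega⟩
  · exact ⟨0, -1, -1, by omega⟩
  · exact ⟨0, 0, -1, by omega⟩

theorem lt_of_sum (v : List (Fin 3)) {k l : ℕ} 
    (h : 4 * prefCount v 0 k + 3 * prefCount v 1 k + 3 * prefCount v 2 k <
      4 * prefCount v 0 l + 3 * prefCount v 1 l + 3 * prefCount v 2 l) : k < l := by
  by_contra! hl
  have h0 := prefCount_mono v 0 hl
  have h1 := prefCount_mono v 1 hl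
  have h2 := prefCount_mono v 2 hl
  omega

theorem CutFree.dek {v : List (Fin 3)} (hv : CutFree v) : CutFree (dek v) := by
  intro p q r s hpq hqr hrs hs h1 h2
  obtain ⟨k, hk, hkd⟩ := dec_exists v p (by omega)
  obtain ⟨l, hl, hld⟩ := dec_exists v q (by omega)
  obtain ⟨m, hm, hmd⟩ := dec_exists v r (by omega)
  obtain ⟨n, hn, hnd⟩ := dec_exists v s (by omega)
  obtain ⟨α₁, β₁, γ₁, e1, e2, e3, d1⟩ := hkd.elim
  obtain ⟨α₂, β₂, γ₂, f1, f2, f3, d2⟩ := hld.elim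
  obtain ⟨α₃, β₃, γ₃, g1, g2, g3, d3⟩ := hmd.elim
  obtain ⟨α₄, β₄, γ₄, i1, i2, i3, d4⟩ := hnd.elim
  have s1 := prefCount_sum (_root_.dek v) p (by omega)
  have s2 := prefCount_sum (_root_.dek v) q (by omega)
  have s3 := prefCount_sum (_root_.dek v) r (by omega)
  have s4 := prefCount_sum (_root_.dek v) s (by omega)
  have a0 := h1 0
  have a1 := h1 1
  have a2 := h1 2
  have b0 := h2 0
  have b1 := h2 1
  have b2 := h2 2
  have m1 : ∃ z, 4 * (α₁ + α₃ - 2 * α₂) + (β₁ + β₃ - 2 * β₂) + 5 * (γ₁ + γ₃ - 2 * γ₂) = 7 * z := by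
    refine ⟨-(2 * (prefCount v 0 k + prefCount v 0 m - 2 * prefCount v 0 l)
      + (prefCount v 1 k + prefCount v 1 m - 2 * prefCount v 1 l)
      + 2 * (prefCount v 2 k + prefCount v 2 m - 2 * prefCount v 2 l)), ?_⟩
    linarith
  have m2 : ∃ z, 4 * (α₂ + α₄ - 2 * α₃) + (β₂ + β₄ - 2 * β₃) + 5 * (γ₂ + γ₄ - 2 * γ₃) = 7 * z := by
    refine ⟨-(2 * (prefCount v 0 l + prefCount v 0 n - 2 * prefCount v 0 m)
      + (prefCount v 1 l + prefCount v 1 n - 2 * prefCount v 1 m)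
      + 2 * (prefCount v 2 l + prefCount v 2 n - 2 * prefCount v 2 m)), ?_⟩
    linarith
  have heq : (α₂ = α₁ ∧ β₂ = β₁ ∧ γ₂ = γ₁) ∧ (α₃ = α₁ ∧ β₃ = β₁ ∧ γ₃ = γ₁) ∧
      (α₄ = α₁ ∧ β₄ = β₁ ∧ γ₄ = γ₁) := by
    obtain ⟨z, hz⟩ := m1
    obtain ⟨y, hy⟩ := m2
    clear e1 e2 e3 f1 f2 f3 g1 g2 g3 i1 i2 i3 s1 s2 s3 s4 a0 a1 a2 b0 b1 b2 h1 h2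
    rcases d1 with ⟨rfl, rfl, rfl⟩ | ⟨rfl, rfl, rfl⟩ | ⟨rfl, rfl, rfl⟩ | ⟨rfl, rfl, rfl⟩ <;>
    rcases d2 with ⟨rfl, rfl, rfl⟩ | ⟨rfl, rfl, rfl⟩ | ⟨rfl, rfl, rfl⟩ | ⟨rfl, rfl, rfl⟩ <;>
    rcases d3 with ⟨rfl, rfl, rfl⟩ | ⟨rfl, rfl, rfl⟩ | ⟨rfl, rfl, rfl⟩ | ⟨rfl, rfl, rfl⟩ <;>
    first
    | (exfalso; omega)
    | (rcases d4 with ⟨rfl, rfl, rfl⟩ | ⟨rfl, rfl, rfl⟩ | ⟨rfl, rfl, rfl⟩ | ⟨rfl, rfl, rfl⟩ <;>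
        omega)
  clear m1 m2 d1 d2 d3 d4
  obtain ⟨⟨rfl, rfl, rfl⟩, ⟨rfl, rfl, rfl⟩, ⟨rfl, rfl, rfl⟩⟩ := heq
  zify at hpq hqr hrs
  refine hv k l m n (lt_of_sum v (by linarith)) (lt_of_sum v (by linarith))
    (lt_of_sum v (by linarith)) hn ?_ ?_
  · intro x
    fin_cases x <;> simp only [Fin.zero_eta, Fin.mk_one, Fin.reduceFinMk] <;> linarith
  · intro x
    fin_cases x <;> simp only [Fin.zero_eta, Fin.mk_one, Fin.reduceFinMk] <;> linarith

/-- Iterates of Dekking's morphism on the letter `0`. -/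
def dekWord : ℕ → List (Fin 3)
  | 0 => [0]
  | n + 1 => dek (dekWord n)

theorem dekWord_cutFree (n : ℕ) : CutFree (dekWord n) := by
  induction n with
  | zero =>
    intro p q r s hpq hqr hrs hs
    simp [dekWord] at hs
    omega
  | succ n ih => exact ih.dek

theorem dek_prefix {u v : List (Fin 3)} (h : u <+: v) : dek u <+: dek v := by
  obtain ⟨t, rfl⟩ := h
  exact ⟨dek t, by simp [dek]⟩

theorem dekWord_prefix_succ (n : ℕ) : dekWord n <+: dekWord (n + 1) := by
  induction n with
  | zero => exact ⟨[0, 1, 2], rfl⟩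
  | succ n ih => exact dek_prefix ih

theorem dekWord_prefix {m n : ℕ} (h : m ≤ n) : dekWord m <+: dekWord n := by
  induction n, h using Nat.le_induction with
  | base => exact List.prefix_rfl
  | succ n _ ih => exact ih.trans (dekWord_prefix_succ n)

theorem dek_length (v : List (Fin 3)) : 3 * v.length ≤ (dek v).length := by
  induction v with
  | nil => simp
  | cons a v ih =>
    have hd : dek (a :: v) = dekLetter a ++ dek v := by simp [dek]
    rw [hd]
    fin_cases a <;> simp [dekLetter] <;> omega

theorem dekWord_length (n : ℕ) : n < (dekWord n).length := by
  induction n with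
  | zero => simp [dekWord]
  | succ n ih =>
    have := dek_length (dekWord n)
    simp only [dekWord]
    omega

theorem dekWord_get {i n : ℕ} (h : i < (dekWord n).length) :
    (dekWord i)[i]'(dekWord_length i) = (dekWord n)[i] := by
  rcases le_total i n with hin | hin
  · exact (dekWord_prefix hin).getElem _
  · exact ((dekWord_prefix hin).getElem _).symm

theorem exists_abelian_cube_free_infinite_word_three_letters :
    ∃ w : ℕ → Fin 3, ∀ i m : ℕ,
      ¬ AbelianCube (List.ofFn fun j : Fin m => w (i + j)) := by
  refine ⟨fun i => (dekWord i)[i]'(dekWord_length i), ?_⟩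
  rintro i m ⟨u₁, u₂, u₃, hne, hl1, hl2, hp1, hp2, hw⟩
  have hlen := dekWord_length (i + m)
  have hfac : (List.ofFn fun j : Fin m => (dekWord (i + j))[i + (j : ℕ)]'(dekWord_length _)) =
      ((dekWord (i + m)).drop i).take m := by
    apply List.ext_getElem
    · simp
      omega
    · intro j h1 h2
      have hj : j < m := by simpa using h1
      simp only [List.getElem_ofFn, List.getElem_take, List.getElem_drop]
      exact dekWord_get _
  rw [hfac] at hw
  have hsplit : dekWord (i + m) = (dekWord (i + m)).take i ++
      (u₁ ++ u₂ ++ u₃ ++ ((dekWord (i + m)).drop i).drop m) := by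
    rw [← hw, List.take_append_drop, List.take_append_drop]
  have hx : ((dekWord (i + m)).take i).length = i := by
    rw [List.length_take]; omega
  generalize (dekWord (i + m)).take i = x at hsplit hx
  generalize ((dekWord (i + m)).drop i).drop m = y at hsplit
  have hfree := dekWord_cutFree (i + m)
  rw [hsplit] at hfree
  have hpos : 0 < u₁.length := List.length_pos_iff.mpr hne
  have t0 : (x ++ (u₁ ++ u₂ ++ u₃ ++ y)).take x.length = x := by simp
  have t1 : (x ++ (u₁ ++ u₂ ++ u₃ ++ y)).take (x ++ u₁).length = x ++ u₁ := by
    rw [show x ++ (u₁ ++ u₂ ++ u₃ ++ y) = (x ++ u₁) ++ (u₂ ++ u₃ ++ y) by simp, List.take_left]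
  have t2 : (x ++ (u₁ ++ u₂ ++ u₃ ++ y)).take (x ++ u₁ ++ u₂).length = x ++ u₁ ++ u₂ := by
    rw [show x ++ (u₁ ++ u₂ ++ u₃ ++ y) = (x ++ u₁ ++ u₂) ++ (u₃ ++ y) by simp, List.take_left]
  have t3 : (x ++ (u₁ ++ u₂ ++ u₃ ++ y)).take (x ++ u₁ ++ u₂ ++ u₃).length
      = x ++ u₁ ++ u₂ ++ u₃ := by
    rw [show x ++ (u₁ ++ u₂ ++ u₃ ++ y) = (x ++ u₁ ++ u₂ ++ u₃) ++ y by simp, List.take_left]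
  refine hfree x.length (x ++ u₁).length (x ++ u₁ ++ u₂).length (x ++ u₁ ++ u₂ ++ u₃).length
    ?_ ?_ ?_ ?_ ?_ ?_
  · simp only [List.length_append]; omega
  · simp only [List.length_append]; omega
  · simp only [List.length_append]; omega
  · simp only [List.length_append]; omega
  · intro a
    have := hp1 a
    simp only [prefCount, t0, t1, t2, List.count_append]
    omega
  · intro a
    have := hp2 a
    simp only [prefCount, t1, t2, t3, List.count_append]
    omega
end

section
/- There exists an infinite word over a two-letter alphabet that contains no abelian fourth power as a factor (Dekking's theorem). -/
namespace Dekking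

/-- Dekking's morphism on letters. -/
def h : Bool → List Bool
  | false => [false, true, true]
  | true => [false, false, false, true]

/-- Dekking's morphism on words. -/
def H (u : List Bool) : List Bool := u.flatMap h

/-- Number of letters `false` among the first `n` letters. -/
def C (l : List Bool) (n : ℕ) : ℕ := (l.take n).count false

/-- Prefix-count form of containing an abelian fourth power. -/
def P (l : List Bool) : Prop :=
  ∃ i d e : ℕ, 0 < d ∧ i + 4 * d ≤ l.length ∧
    C l (i + d) = C l i + e ∧ C l (i + 2 * d) = C l i + 2 * e ∧
    C l (i + 3 * d) = C l i + 3 * e ∧ C l (i + 4 * d) = C l i + 4 * e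

lemma C_add (l : List Bool) (m t : ℕ) : C l (m + t) = C l m + ((l.drop m).take t).count false := by
  simp [C, List.take_add, List.count_append]

lemma C_le (l : List Bool) (m n : ℕ) (hmn : m ≤ n) : C l m ≤ C l n ∧ C l n ≤ C l m + (n - m) := by
  obtain ⟨t, rfl⟩ := Nat.exists_eq_add_of_le hmn
  have h1 := C_add l m t
  have h2 : ((l.drop m).take t).count false ≤ ((l.drop m).take t).length := List.count_le_length
  have h3 : ((l.drop m).take t).length ≤ t := by simp
  omega

lemma H_snoc (u : List Bool) (c : Bool) : H (u ++ [c]) = H u ++ h c := by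
  simp [H]

lemma H_counts (u : List Bool) : (H u).length + u.count false = 4 * u.length ∧
    (H u).count false + 2 * u.count false = 3 * u.length := by
  induction u using List.reverseRecOn with
  | nil => simp [H]
  | append_singleton u c ih =>
    rw [H_snoc]
    cases c <;> simp [h] <;> omega

lemma key (u : List Bool) : ∀ n ≤ (H u).length, ∃ k ≤ u.length,
    (n + C u k = 4 * k ∧ C (H u) n + 2 * C u k = 3 * k) ∨
    (n + C u k = 4 * k + 1 ∧ C (H u) n + 2 * C u k = 3 * k + 1) ∨
    (n + C u k = 4 * k + 2 ∧ C (H u) n + 2 * C u k = 3 * k + 2) ∨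
    (n + C u k + 1 = 4 * k ∧ C (H u) n + 2 * C u k = 3 * k) := by
  induction u using List.reverseRecOn with
  | nil => 
    intro n hn
    refine ⟨0, by simp, ?_⟩
    simp [H] at hn
    subst hn
    simp [C]
  | append_singleton u c ih =>
    intro n hn
    rw [H_snoc] at hn ⊢
    by_cases hle : n ≤ (H u).length
    · obtain ⟨k, hk, hh⟩ := ih n hle
      refine ⟨k, by simp; omega, ?_⟩
      have e1 : C (u ++ [c]) k = C u k := by simp [C, List.take_append_of_le_length hk]
      have e2 : C (H u ++ h c) n = C (H u) n := by simp [C, List.take_append_of_le_length hle]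
      rw [e1, e2]; exact hh
    · obtain ⟨t, rfl⟩ := Nat.exists_eq_add_of_le (not_le.mp hle).le
      have e2 : C (H u ++ h c) ((H u).length + t) = (H u).count false + ((h c).take t).count false := by
        simp [C, List.take_append, List.take_of_length_le]
      have e0 : C (u ++ [c]) u.length = u.count false := by simp [C]
      have e1 : C (u ++ [c]) (u.length + 1) = u.count false + [c].count false := by
        simp [C, List.take_append, List.take_of_length_le]
      obtain ⟨h1, h2⟩ := H_counts u
      rw [e2]
      cases c
      · have ht : t ≤ 3 := by simpa [h] using hn
        interval_cases t
        · omega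
        · refine ⟨u.length, by simp, ?_⟩; rw [e0]; simp [h]; omega
        · refine ⟨u.length + 1, by simp, ?_⟩; rw [e1]; simp [h]; omega
        · refine ⟨u.length + 1, by simp, ?_⟩; rw [e1]; simp [h]; omega
      · have ht : t ≤ 4 := by simpa [h] using hn
        interval_cases t
        · omega
        · refine ⟨u.length, by simp, ?_⟩; rw [e0]; simp [h]; omega
        · refine ⟨u.length, by simp, ?_⟩; rw [e0]; simp [h]; omega
        · refine ⟨u.length + 1, by simp, ?_⟩; rw [e1]; simp [h]; omega
        · refine ⟨u.length + 1, by simp, ?_⟩; rw [e1]; simp [h]; omega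

/-- The relation between a position in the image and its residue class. -/
def R (n c k x r : ℕ) : Prop :=
  (r = 0 ∧ n + x = 4 * k ∧ c + 2 * x = 3 * k) ∨
  (r = 1 ∧ n + x = 4 * k + 1 ∧ c + 2 * x = 3 * k + 1) ∨
  (r = 2 ∧ n + x = 4 * k + 2 ∧ c + 2 * x = 3 * k + 2) ∨
  (r = 3 ∧ n + x + 1 = 4 * k ∧ c + 2 * x = 3 * k)

lemma key' (u : List Bool) (n : ℕ) (hn : n ≤ (H u).length) :
    ∃ k ≤ u.length, ∃ r, R n (C (H u) n) k (C u k) r := by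
  obtain ⟨k, hk, h1 | h1 | h1 | h1⟩ := key u n hn
  · exact ⟨k, hk, 0, by unfold R; omega⟩
  · exact ⟨k, hk, 1, by unfold R; omega⟩
  · exact ⟨k, hk, 2, by unfold R; omega⟩
  · exact ⟨k, hk, 3, by unfold R; omega⟩

lemma R_ne {n c k x r : ℕ} (hR : R n c k x r) (s : ℤ) (hs : s = 2 * (n : ℤ) - c) :
    s % 5 ≠ 4 := by
  unfold R at hR; omega

lemma R_same {n c k x r n' c' k' x' r' : ℕ} (hR : R n c k x r) (hR' : R n' c' k' x' r')
    (g : ℤ) (hg : 2 * (n' : ℤ) - c' = 2 * (n : ℤ) - c + 5 * g) : r' = r := by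
  have h1 : (2 * (n : ℤ) - c) % 5 = r := by unfold R at hR; omega
  have h2 : (2 * (n' : ℤ) - c') % 5 = r' := by unfold R at hR'; omega
  omega

/-- Linear consequence for two positions of the same class. -/
lemma R_lin {n c k x r n' c' k' x' : ℕ} (hR : R n c k x r) (hR' : R n' c' k' x' r) :
    (5 * ((k' : ℤ) - k) = 2 * ((n' : ℤ) - n) - ((c' : ℤ) - c)) ∧
    ((x' : ℤ) - x = 4 * ((k' : ℤ) - k) - ((n' : ℤ) - n)) := by
  unfold R at hR hR'; omega

lemma res_eq (s f : ℤ) (h0 : s % 5 ≠ 4) (h1 : (s + f) % 5 ≠ 4) (h2 : (s + 2 * f) % 5 ≠ 4)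
    (h3 : (s + 3 * f) % 5 ≠ 4) (h4 : (s + 4 * f) % 5 ≠ 4) : f % 5 = 0 := by
  have : f % 5 = 0 ∨ f % 5 = 1 ∨ f % 5 = 2 ∨ f % 5 = 3 ∨ f % 5 = 4 := by omega
  rcases this with h | h | h | h | h <;> omega

lemma descent (u : List Bool) (hP : P (H u)) : P u := by
  obtain ⟨i, d, e, hd, hlen, c1, c2, c3, c4⟩ := hP
  have hed := C_le (H u) i (i + d) (by omega)
  obtain ⟨k0, l0, r0, R0⟩ := key' u i (by omega)
  obtain ⟨k1, l1, r1, R1⟩ := key' u (i + d) (by omega)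
  obtain ⟨k2, l2, r2, R2⟩ := key' u (i + 2 * d) (by omega)
  obtain ⟨k3, l3, r3, R3⟩ := key' u (i + 3 * d) (by omega)
  obtain ⟨k4, l4, r4, R4⟩ := key' u (i + 4 * d) (by omega)
  rw [c1] at R1 hed; rw [c2] at R2; rw [c3] at R3; rw [c4] at R4
  generalize C (H u) i = c at *
  have hf := res_eq (2 * i - c) (2 * d - e) (R_ne R0 _ rfl) (R_ne R1 _ (by push_cast; ring))
    (R_ne R2 _ (by push_cast; ring)) (R_ne R3 _ (by push_cast; ring))
    (R_ne R4 _ (by push_cast; ring))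
  obtain ⟨g, hg⟩ := Int.dvd_of_emod_eq_zero hf
  clear hf
  obtain rfl : r1 = r0 := R_same R0 R1 g (by push_cast; linarith)
  obtain rfl : r2 = r1 := R_same R0 R2 (2 * g) (by push_cast; linarith)
  obtain rfl : r3 = r2 := R_same R0 R3 (3 * g) (by push_cast; linarith)
  obtain rfl : r4 = r3 := R_same R0 R4 (4 * g) (by push_cast; linarith)
  have s1 := R_lin R0 R1
  have s2 := R_lin R0 R2
  have s3 := R_lin R0 R3
  have s4 := R_lin R0 R4
  push_cast at s1 s2 s3 s4
  obtain ⟨D, rfl⟩ : ∃ D, k1 = k0 + D := ⟨k1 - k0, by omega⟩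
  obtain rfl : k2 = k0 + 2 * D := by omega
  obtain rfl : k3 = k0 + 3 * D := by omega
  obtain rfl : k4 = k0 + 4 * D := by omega
  have hm := C_le u k0 (k0 + D) (by omega)
  refine ⟨k0, D, C u (k0 + D) - C u k0, by omega, by omega, ?_, ?_, ?_, ?_⟩ <;> omega

/-- Iterates of the morphism. -/
def W : ℕ → List Bool
  | 0 => [false]
  | n + 1 => H (W n)

lemma not_P_W (n : ℕ) : ¬ P (W n) := by
  induction n with
  | zero =>
    rintro ⟨i, d, e, hd, hlen, -⟩
    simp [W] at hlen
    omega
  | succ n ih => exact fun hp => ih (descent _ hp)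

lemma W_prefix (n : ℕ) : W n <+: W (n + 1) := by
  induction n with
  | zero => exact ⟨[true, true], by simp [W, H, h]⟩
  | succ n ih =>
    obtain ⟨t, ht⟩ := ih
    refine ⟨H t, ?_⟩
    change H (W n) ++ H t = H (W (n + 1))
    rw [← ht]; simp [H]

lemma W_mono {m n : ℕ} (hmn : m ≤ n) : W m <+: W n := by
  induction n, hmn using Nat.le_induction with
  | base => exact List.prefix_refl _
  | succ n _ ih => exact ih.trans (W_prefix n)

lemma W_length (n : ℕ) : n < (W n).length := by
  induction n with
  | zero => simp [W]
  | succ n ih =>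
    have h1 := (H_counts (W n)).1
    have h2 : (W n).count false ≤ (W n).length := List.count_le_length
    change _ < (H (W n)).length
    omega

/-- The infinite fixed point. -/
def w (i : ℕ) : Bool := (W i)[i]'(W_length i)

lemma w_eq (n i : ℕ) (hi : i ≤ n) : (W n)[i]'(lt_of_le_of_lt hi (W_length n)) = w i := by
  unfold w
  exact ((W_mono hi).getElem (W_length i)).symm

lemma factor_eq (i m : ℕ) :
    (List.ofFn fun j : Fin m => w (i + j)) = ((W (i + m)).drop i).take m := by
  have hl := W_length (i + m)
  apply List.ext_getElem
  · simp; omega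
  · intro j h1 h2
    simp at h1
    simp [w_eq (i + m) (i + j) (by omega)]

end Dekking


/-- A word is an abelian fourth power if it is the concatenation of four
nonempty pairwise Parikh-equivalent words of the same length. -/
def AbelianFourthPower {α : Type*} [DecidableEq α] (w : List α) : Prop :=
  ∃ u₁ u₂ u₃ u₄ : List α, u₁ ≠ [] ∧
    u₁.length = u₂.length ∧ u₂.length = u₃.length ∧ u₃.length = u₄.length ∧
    ParikhEq u₁ u₂ ∧ ParikhEq u₂ u₃ ∧ ParikhEq u₃ u₄ ∧ w = u₁ ++ u₂ ++ u₃ ++ u₄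

/-- Dekking's theorem: there is an infinite binary word none of whose factors is
an abelian fourth power. -/
theorem exists_abelian_fourth_power_free_infinite_binary_word :
    ∃ w : ℕ → Bool, ∀ i m : ℕ,
      ¬ AbelianFourthPower (List.ofFn fun j : Fin m => w (i + j)) := by

  refine ⟨Dekking.w, fun i m => ?_⟩
  rintro ⟨u₁, u₂, u₃, u₄, hne, l1, l2, l3, p1, p2, p3, hw⟩
  rw [Dekking.factor_eq] at hw
  have hl := Dekking.W_length (i + m)
  have hm : m = 4 * u₁.length := by
    have := congrArg List.length hw
    simp at this
    omega
  have hd : 0 < u₁.length := List.length_pos_iff.mpr hne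
  have q1 := p1 false
  have q2 := p2 false
  have q3 := p3 false
  have hC : ∀ t ≤ m, Dekking.C (Dekking.W (i + m)) (i + t)
      = Dekking.C (Dekking.W (i + m)) i + ((u₁ ++ u₂ ++ u₃ ++ u₄).take t).count false := by
    intro t ht
    rw [Dekking.C_add, ← hw, List.take_take, min_eq_left ht]
  refine Dekking.not_P_W (i + m)
    ⟨i, u₁.length, u₁.count false, hd, by omega, ?_, ?_, ?_, ?_⟩
  · rw [hC _ (by omega)]; simp
  · rw [hC _ (by omega), show 2 * u₁.length = (u₁ ++ u₂).length by simp; omega,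
      List.append_assoc (u₁ ++ u₂), List.take_left, List.count_append]
    omega
  · rw [hC _ (by omega), show 3 * u₁.length = (u₁ ++ u₂ ++ u₃).length by simp; omega,
      List.take_left, List.count_append, List.count_append]
    omega
  · rw [hC _ (by omega), show 4 * u₁.length = (u₁ ++ u₂ ++ u₃ ++ u₄).length by simp; omega,
      List.take_length, List.count_append, List.count_append, List.count_append]
    omega
end

section
/- There exists an infinite binary word whose only square factors are aa, bb and abab; that is, every factor of the word of the form xx with x nonempty is equal to aa, bb or abab (Fraenkel–Simpson theorem). -/
namespace FS

/-- Leech's 13-uniform square-free morphism. -/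
def leech : ℕ → List ℕ
  | 0 => [0, 1, 2, 1, 0, 2, 1, 2, 0, 1, 2, 1, 0]
  | 1 => [1, 2, 0, 2, 1, 0, 2, 0, 1, 2, 0, 2, 1]
  | _ => [2, 0, 1, 0, 2, 1, 0, 1, 2, 0, 1, 0, 2]

/-- A 50-uniform morphism to the binary alphabet. -/
def bin : ℕ → List ℕ
  | 0 => [0, 0, 0, 1, 0, 1, 1, 0, 0, 0, 1, 1, 1, 0, 0, 1, 0, 1, 1, 1, 0, 0, 0, 1, 1,
   0, 0, 1, 0, 1, 1, 0, 0, 0, 1, 0, 1, 1, 1, 0, 0, 1, 0, 1, 1, 0, 0, 1, 1, 1]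
  | 1 => [0, 0, 0, 1, 0, 1, 1, 1, 0, 0, 1, 0, 1, 1, 0, 0, 0, 1, 0, 1, 1, 1, 0, 0, 0,
   1, 1, 0, 0, 1, 0, 1, 1, 0, 0, 0, 1, 1, 1, 0, 0, 1, 0, 1, 1, 0, 0, 1, 1, 1]
  | _ => [0, 0, 0, 1, 1, 0, 0, 1, 0, 1, 1, 1, 0, 0, 0, 1, 0, 1, 1, 0, 0, 0, 1, 1, 1,
   0, 0, 1, 0, 1, 1, 0, 0, 0, 1, 0, 1, 1, 1, 0, 0, 1, 0, 1, 1, 0, 0, 1, 1, 1]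

/-- The square-free ternary words of length 5. -/
def F5 : List (List ℕ) :=
  [[0, 1, 0, 2, 0], [0, 1, 0, 2, 1], [0, 1, 2, 0, 1], [0, 1, 2, 0, 2],
   [0, 1, 2, 1, 0], [0, 2, 0, 1, 0], [0, 2, 0, 1, 2], [0, 2, 1, 0, 1],
   [0, 2, 1, 0, 2], [0, 2, 1, 2, 0], [1, 0, 1, 2, 0], [1, 0, 1, 2, 1],
   [1, 0, 2, 0, 1], [1, 0, 2, 1, 0], [1, 0, 2, 1, 2], [1, 2, 0, 1, 0],
   [1, 2, 0, 1, 2], [1, 2, 0, 2, 1], [1, 2, 1, 0, 1], [1, 2, 1, 0, 2],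
   [2, 0, 1, 0, 2], [2, 0, 1, 2, 0], [2, 0, 1, 2, 1], [2, 0, 2, 1, 0],
   [2, 0, 2, 1, 2], [2, 1, 0, 1, 2], [2, 1, 0, 2, 0], [2, 1, 0, 2, 1],
   [2, 1, 2, 0, 1], [2, 1, 2, 0, 2]]

/-- Compare the first `n` letters (lazily); exhausted lists count as agreeing. -/
def eqPre : ℕ → List ℕ → List ℕ → Bool
  | n + 1, x :: xs, y :: ys => bif Nat.beq x y then eqPre n xs ys else false
  | _, _, _ => true

def get (l : List ℕ) (n : ℕ) : ℕ := l[n]?.getD 0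

theorem get_drop (l : List ℕ) (r n : ℕ) : get (l.drop r) n = get l (r + n) := by
  simp [get]

theorem eqPre_of (n : ℕ) (l l' : List ℕ) (h : ∀ j < n, get l j = get l' j) :
    eqPre n l l' = true := by
  induction n generalizing l l' with
  | zero => simp [eqPre]
  | succ n ih =>
    match l, l' with
    | [], _ => simp [eqPre]
    | _ :: _, [] => simp [eqPre]
    | x :: xs, y :: ys =>
      have h0 : x = y := by simpa [get] using h 0 (by omega)
      subst h0
      have : eqPre n xs ys = true := by
        apply ih
        intro j hj
        simpa [get] using h (j + 1) (by omega)
      simp [eqPre, this]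

def chkP (ok : ℕ → List ℕ → Bool) : ℕ → ℕ → List ℕ → List ℕ → Bool
  | 0, _, _, _ => true
  | k + 1, p, l, l' =>
    bif eqPre p l l' then (bif ok p l then chkP ok k (p + 1) l l'.tail else false)
    else chkP ok k (p + 1) l l'.tail

def chkR (ok : ℕ → List ℕ → Bool) (P : ℕ) : ℕ → List ℕ → Bool
  | 0, _ => true
  | k + 1, W => bif chkP ok P 1 W W.tail then chkR ok P k W.tail else false

theorem chkP_spec (ok : ℕ → List ℕ → Bool) (k p : ℕ) (l l' : List ℕ)
    (h : chkP ok k p l l' = true) (d : ℕ) (hd : d < k)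
    (he : eqPre (p + d) l (l'.drop d) = true) : ok (p + d) l = true := by
  induction k generalizing p l' d with
  | zero => omega
  | succ k ih =>
    have h2 : chkP ok k (p + 1) l l'.tail = true ∧ (eqPre p l l' = true → ok p l = true) := by
      simp only [chkP] at h
      cases h1 : eqPre p l l' <;> cases h3 : ok p l <;> simp_all
    cases d with
    | zero => exact h2.2 (by simpa using he)
    | succ d =>
      have := ih (p + 1) l'.tail h2.1 d (by omega)
        (by rw [List.drop_tail, show p + 1 + d = p + (d + 1) by omega]; exact he)
      rwa [show p + 1 + d = p + (d + 1) by omega] at this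

theorem chkR_spec (ok : ℕ → List ℕ → Bool) (P k : ℕ) (W : List ℕ)
    (h : chkR ok P k W = true) (r : ℕ) (hr : r < k) (p : ℕ) (hp : 0 < p) (hP : p ≤ P)
    (he : ∀ j < p, get W (r + j) = get W (r + p + j)) : ok p (W.drop r) = true := by
  induction k generalizing W r with
  | zero => omega
  | succ k ih =>
    have h2 : chkP ok P 1 W W.tail = true ∧ chkR ok P k W.tail = true := by
      simp only [chkR] at h
      cases h1 : chkP ok P 1 W W.tail <;> simp_all
    cases r with
    | zero =>
      have := chkP_spec ok P 1 W W.tail h2.1 (p - 1) (by omega)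
        (by
          apply eqPre_of
          intro j hj
          rw [List.drop_tail, get_drop]
          have := he j (by omega)
          simp only [zero_add] at this
          rw [this]; congr 1; omega)
      rw [show 1 + (p - 1) = p by omega] at this
      simpa using this
    | succ r =>
      have := ih W.tail h2.2 r (by omega) (by
        intro j hj
        have := he j hj
        rw [← List.drop_one, get_drop, get_drop]
        convert this using 2 <;> omega)
      simpa [List.drop_tail] using this

theorem get_flatMap (L : ℕ) (hL : 0 < L) (h : ℕ → List ℕ) (len : ∀ a, (h a).length = L)
    (f : List ℕ) (n : ℕ) (hn : n < f.length * L) :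
    get (f.flatMap h) n = get (h (get f (n / L))) (n % L) := by
  induction f generalizing n with
  | nil => simp at hn
  | cons a f ih =>
    by_cases hlt : n < L
    · rw [Nat.div_eq_of_lt hlt, Nat.mod_eq_of_lt hlt]
      simp [get, List.getElem?_append, len, hlt]
    · obtain ⟨m, rfl⟩ : ∃ m, n = m + L := ⟨n - L, by omega⟩
      have := ih m (by simp only [List.length_cons, Nat.succ_mul] at hn; omega)
      rw [Nat.add_div_right _ hL, Nat.add_mod_right]
      have h1 : get ((a :: f).flatMap h) (m + L) = get (f.flatMap h) m := by
        simp [get, List.getElem?_append, len]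
      rw [h1, this]
      simp [get]

/-- `w` is the image of `t` under the `L`-uniform morphism `h`. -/
def Img (L : ℕ) (h : ℕ → List ℕ) (t w : ℕ → ℕ) : Prop :=
  ∀ n, w n = get (h (t (n / L))) (n % L)

def win (t : ℕ → ℕ) (q : ℕ) : List ℕ := [t q, t (q + 1), t (q + 2), t (q + 3), t (q + 4)]

theorem get_win (t : ℕ → ℕ) (q n : ℕ) (hn : n < 5) : get (win t q) n = t (q + n) := by
  interval_cases n <;> simp [get, win]

theorem Img.block {L : ℕ} {h : ℕ → List ℕ} {t w : ℕ → ℕ} (hw : Img L h t w)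
    (q j : ℕ) (hj : j < L) : w (q * L + j) = get (h (t q)) j := by
  rw [hw, show q * L + j = j + L * q by ring, Nat.add_mul_div_left _ _ (by omega),
    Nat.add_mul_mod_self_left, Nat.div_eq_of_lt hj, Nat.mod_eq_of_lt hj, zero_add]

theorem Img.win {L : ℕ} {h : ℕ → List ℕ} {t w : ℕ → ℕ} (hw : Img L h t w) (hL : 0 < L)
    (len : ∀ a, (h a).length = L)
    (q n : ℕ) (hn : n < 5 * L) : get ((win t q).flatMap h) n = w (q * L + n) := by
  rw [get_flatMap L hL h len _ _ (by simpa [FS.win] using hn), get_win, hw]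
  · rw [show q * L + n = n + L * q by ring, Nat.add_mul_div_left _ _ hL,
      Nat.add_mul_mod_self_left, Nat.add_comm q]
  · exact Nat.div_lt_of_lt_mul (by linarith)

def Sq (w : ℕ → ℕ) (i p : ℕ) : Prop := ∀ j < p, w (i + j) = w (i + p + j)

/-- Short squares. -/
theorem small {L : ℕ} {h : ℕ → List ℕ} {t w : ℕ → ℕ} (hw : Img L h t w) (hL : 0 < L)
    (len : ∀ a, (h a).length = L) (ht : ∀ n, win t n ∈ F5) (ok : ℕ → List ℕ → Bool) {P : ℕ}
    (hchk : (F5.all fun f => chkR ok P L (f.flatMap h)) = true)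
    (hPL : P ≤ 2 * L - 2) (i p : ℕ) (hp : 0 < p) (hpL : p ≤ P) (hs : Sq w i p) :
    ∃ l, (∀ j < L, get l j = w (i + j)) ∧ ok p l = true := by
  have hr := Nat.mod_lt i hL
  have hi : i / L * L + i % L = i := Nat.div_add_mod' i L
  refine ⟨((win t (i / L)).flatMap h).drop (i % L), ?_, ?_⟩
  · intro j hj
    rw [get_drop, hw.win hL len _ _ (by omega), ← add_assoc, hi]
  · refine chkR_spec ok _ L _ (List.all_eq_true.1 hchk _ (ht _)) _ hr p hp hpL ?_
    intro j hj
    rw [hw.win hL len _ _ (by omega), hw.win hL len _ _ (by omega), ← add_assoc, ← add_assoc,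
      ← add_assoc, hi]
    exact hs j hj

def syncB (L : ℕ) (h : ℕ → List ℕ) : Bool :=
  (List.range 3).all fun a => (List.range 3).all fun b => (List.range 3).all fun c =>
    Nat.beq b c || (List.range L).all fun r =>
      Nat.beq r 0 || !eqPre L (h a) ((h b ++ h c).drop r)

def lcB (L : ℕ) (h : ℕ → List ℕ) : Bool :=
  (List.range 3).all fun a => (List.range 3).all fun b => (List.range 3).all fun c =>
    Nat.beq a b || Nat.beq b c || (List.range L).all fun r =>
      !(eqPre (L - r) ((h a).drop r) ((h b).drop r) && eqPre r (h b) (h c))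

def injB (L : ℕ) (h : ℕ → List ℕ) : Bool :=
  (List.range 3).all fun a => (List.range 3).all fun b => Nat.beq a b || !eqPre L (h a) (h b)

theorem F5_facts : ∀ f ∈ F5, get f 0 < 3 ∧ get f 0 ≠ get f 1 := by decide +kernel

/-- Long squares come from squares in the preimage. -/
theorem big {L : ℕ} {h : ℕ → List ℕ} {t w : ℕ → ℕ} (hw : Img L h t w) (hL : 0 < L)
    (len : ∀ a, (h a).length = L) (ht : ∀ n, win t n ∈ F5)
    (hsync : syncB L h = true) (hlc : lcB L h = true) (hinj : injB L h = true)
    (i p : ℕ) (hpL : 2 * L - 1 ≤ p) (hs : Sq w i p) :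
    ∃ i' k, 0 < k ∧ p = k * L ∧ Sq t i' k := by
  have t3 : ∀ n, t n < 3 := fun n => by
    have := (F5_facts _ (ht n)).1
    rwa [get_win _ _ _ (by omega)] at this
  have tne : ∀ n, t n ≠ t (n + 1) := fun n => by
    have := (F5_facts _ (ht n)).2
    rwa [get_win _ _ _ (by omega), get_win _ _ _ (by omega)] at this
  have hinj' : ∀ x y, (∀ j < L, get (h (t x)) j = get (h (t y)) j) → t x = t y := by
    intro x y hxy
    have := eqPre_of _ _ _ hxy
    simp only [injB, List.all_eq_true, List.mem_range] at hinj
    have h2 := hinj _ (t3 x) _ (t3 y)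
    simpa [this] using h2
  have hlc' : ∀ x y z r, r < L → (∀ j, r ≤ j → j < L → get (h (t x)) j = get (h (t y)) j) →
      (∀ j < r, get (h (t y)) j = get (h (t z)) j) → t x = t y ∨ t y = t z := by
    intro x y z r hr h1 h2
    have e1 : eqPre (L - r) ((h (t x)).drop r) ((h (t y)).drop r) = true := by
      apply eqPre_of
      intro j hj
      rw [get_drop, get_drop]
      exact h1 _ (by omega) (by omega)
    have e2 := eqPre_of _ _ _ h2
    simp only [lcB, List.all_eq_true, List.mem_range] at hlc
    have h3 := hlc _ (t3 x) _ (t3 y) _ (t3 z)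
    simp only [Bool.or_eq_true, List.all_eq_true, List.mem_range] at h3
    rcases h3 with (h3 | h3) | h3
    · exact Or.inl (Nat.eq_of_beq_eq_true h3)
    · exact Or.inr (Nat.eq_of_beq_eq_true h3)
    · have := h3 r hr
      simp [e1, e2] at this
  have hmove : ∀ n, i ≤ n → n < i + p → w n = w (n + p) := by
    intro n h1 h2
    have := hs (n - i) (by omega)
    rwa [show i + (n - i) = n by omega, show i + p + (n - i) = n + p by omega] at this
  -- synchronisation
  have hp0 : p % L = 0 := by
    obtain ⟨m, hm1, hm2⟩ : ∃ m, i ≤ m * L ∧ m * L + 1 ≤ i + L := by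
      refine ⟨(i + L - 1) / L, ?_, ?_⟩
      · have h1 := Nat.div_add_mod' (i + L - 1) L
        have h2 := Nat.mod_lt (i + L - 1) hL
        omega
      · have h1 := Nat.div_mul_le_self (i + L - 1) L
        omega
    have hr := Nat.mod_lt p hL
    have hp := Nat.div_add_mod' p L
    set r := p % L with hrdef
    set k := p / L
    have key : ∀ j < L, get (h (t m)) j = get ((h (t (m + k)) ++ h (t (m + k + 1))).drop r) j := by
      intro j hj
      rw [get_drop, ← hw.block m j hj, hmove _ (by omega) (by omega)]
      by_cases hlt : r + j < L
      · rw [show m * L + j + p = (m + k) * L + (r + j) by rw [add_mul]; omega, hw.block _ _ hlt]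
        simp [get, List.getElem?_append, len, hlt]
      · rw [show m * L + j + p = (m + k + 1) * L + (r + j - L) by
          rw [add_mul, add_mul]; omega, hw.block _ _ (by omega)]
        simp [get, List.getElem?_append, len, hlt]
    have e := eqPre_of _ _ _ key
    simp only [syncB, List.all_eq_true, List.mem_range] at hsync
    have h3 := hsync _ (t3 m) _ (t3 (m + k)) _ (t3 (m + k + 1))
    simp only [Bool.or_eq_true, List.all_eq_true, List.mem_range] at h3
    rcases h3 with h3 | h3
    · exact absurd (Nat.eq_of_beq_eq_true h3) (tne _)
    · rcases h3 r hr with h4 | h4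
      · exact Nat.eq_of_beq_eq_true h4
      · simp [e] at h4
  obtain ⟨k, hk⟩ : ∃ k, p = k * L := ⟨p / L, by have := Nat.div_add_mod' p L; omega⟩
  have hk0 : 0 < k := by
    rcases Nat.eq_zero_or_pos k with rfl | h1
    · omega
    · exact h1
  have hr := Nat.mod_lt i hL
  have hi : i / L * L + i % L = i := Nat.div_add_mod' i L
  set q := i / L
  set r := i % L
  have hblk : ∀ u j, j < L → i ≤ (q + u) * L + j → (q + u) * L + j < i + p →
      get (h (t (q + u))) j = get (h (t (q + u + k))) j := by
    intro u j hj h1 h2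
    rw [← hw.block _ _ hj, hmove _ h1 h2, ← hw.block _ _ hj]
    congr 1
    rw [add_mul (q + u) k]; omega
  have hmid : ∀ u, 0 < u → u < k → t (q + u) = t (q + u + k) := by
    intro u h1 h2
    apply hinj'
    intro j hj
    have h3 : L ≤ u * L := Nat.le_mul_of_pos_left L h1
    have h4 : (u + 1) * L ≤ k * L := Nat.mul_le_mul_right L h2
    rw [add_mul] at h4
    exact hblk u j hj (by rw [add_mul]; omega) (by rw [add_mul]; omega)
  have hedge := hlc' q (q + k) (q + k + k) r hr
    (by
      intro j h1 h2
      exact hblk 0 j h2 (by simp only [add_zero]; omega)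
        (by
          have : L ≤ k * L := Nat.le_mul_of_pos_left L hk0
          simp only [add_zero]; omega))
    (by
      intro j h1
      exact hblk k j (by omega) (by
          have : L ≤ k * L := Nat.le_mul_of_pos_left L hk0
          rw [add_mul]; omega) (by rw [add_mul]; omega))
  rcases hedge with he | he
  · refine ⟨q, k, hk0, hk, ?_⟩
    intro j hj
    rcases Nat.eq_zero_or_pos j with rfl | h1
    · simpa using he
    · rw [hmid j h1 hj]; congr 1; omega
  · refine ⟨q + 1, k, hk0, hk, ?_⟩
    intro j hj
    by_cases h1 : j + 1 < k
    · have := hmid (j + 1) (by omega) h1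
      rw [show q + 1 + j = q + (j + 1) by omega, this]; congr 1; omega
    · rw [show q + 1 + j = q + k by omega, he]; congr 1; omega

/-- The fixed point of Leech's morphism. -/
def t (n : ℕ) : ℕ := if n = 0 then 0 else get (leech (t (n / 13))) (n % 13)
termination_by n
decreasing_by omega

theorem t_img : Img 13 leech t t := by
  intro n
  rcases Nat.eq_zero_or_pos n with rfl | h
  · have : t 0 = 0 := by rw [t]; simp
    simp [this, leech, get]
  · conv_lhs => rw [t]
    rw [if_neg (by omega)]

theorem leech_len (a : ℕ) : (leech a).length = 13 := by
  match a with
  | 0 => rfl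
  | 1 => rfl
  | _ + 2 => rfl

theorem bin_len (a : ℕ) : (bin a).length = 50 := by
  match a with
  | 0 => rfl
  | 1 => rfl
  | _ + 2 => rfl

theorem F5_closed : (F5.all fun f => (List.range 13).all fun r =>
    F5.contains (((f.flatMap leech).drop r).take 5)) = true := by decide +kernel

theorem take5 (l : List ℕ) (hl : 5 ≤ l.length) :
    l.take 5 = [get l 0, get l 1, get l 2, get l 3, get l 4] := by
  match l, hl with
  | a :: b :: c :: d :: e :: l, _ => simp [get]

theorem t_win (n : ℕ) : win t n ∈ F5 := by
  induction n using Nat.strong_induction_on with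
  | _ n ih =>
    rcases Nat.eq_zero_or_pos n with rfl | h
    · have h0 : t 0 = 0 := by rw [t]; simp
      have hh : ∀ j < 13, t j = get (leech 0) j := by
        intro j hj
        have := t_img.block 0 j hj
        rwa [zero_mul, zero_add, h0] at this
      simp only [win, zero_add]
      rw [h0, hh 1 (by omega), hh 2 (by omega), hh 3 (by omega), hh 4 (by omega)]
      decide
    · have hm := ih (n / 13) (by omega)
      have hc := F5_closed
      simp only [List.all_eq_true, List.mem_range] at hc
      have := hc _ hm (n % 13) (by omega)
      rw [List.contains_iff_mem, take5 _ (by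
        rw [List.length_drop]
        simp only [win, List.flatMap_cons, List.flatMap_nil, List.length_append, leech_len,
          List.length_nil]
        omega)] at this
      simp only [get_drop] at this
      have e : ∀ j < 5, get ((win t (n / 13)).flatMap leech) (n % 13 + j) = t (n + j) := by
        intro j hj
        rw [t_img.win (by omega) leech_len _ _ (by omega)]
        congr 1; omega
      rw [e 0 (by omega), e 1 (by omega), e 2 (by omega), e 3 (by omega), e 4 (by omega)] at this
      exact this

theorem leech_chk : (F5.all fun f => chkR (fun _ _ => false) (2 * 13 - 2) 13 (f.flatMap leech))
    = true := by decide +kernel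

theorem leech_sync : syncB 13 leech = true := by decide +kernel
theorem leech_lc : lcB 13 leech = true := by decide +kernel
theorem leech_inj : injB 13 leech = true := by decide +kernel
theorem bin_sync : syncB 50 bin = true := by decide +kernel
theorem bin_lc : lcB 50 bin = true := by decide +kernel
theorem bin_inj : injB 50 bin = true := by decide +kernel

theorem t_sqfree (p : ℕ) : 0 < p → ∀ i, ¬ Sq t i p := by
  induction p using Nat.strong_induction_on with
  | _ p ih =>
    intro hp i hs
    by_cases hb : p ≤ 2 * 13 - 2
    · obtain ⟨l, _, h⟩ := small t_img (by omega) leech_len t_win _ leech_chk le_rfl i p hp hb hs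
      simp at h
    · obtain ⟨i', k, hk, hkp, hsq⟩ := big t_img (by omega) leech_len t_win leech_sync leech_lc
        leech_inj i p (by omega) hs
      exact ih k (by omega) hk i' hsq

/-- Permitted short squares: `aa`, `bb`, `abab`. -/
def okB (p : ℕ) (l : List ℕ) : Bool :=
  Nat.beq p 1 || (Nat.beq p 2 && (Nat.beq (get l 0) 0 && Nat.beq (get l 1) 1))

theorem bin_chk2 : (F5.all fun f => chkR okB 2 50 (f.flatMap bin)) = true := by
  decide +kernel

/-- Pack a list of bits into a natural number. -/
def toN : List ℕ → ℕ
  | [] => 0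
  | a :: l => 2 * toN l + a % 2

theorem testBit_toN (l : List ℕ) (j : ℕ) : (toN l).testBit j = decide (get l j % 2 = 1) := by
  induction l generalizing j with
  | nil => simp [toN, get]
  | cons a l ih =>
    cases j with
    | zero => simp [toN, get, Nat.testBit_zero, Nat.add_mod]
    | succ j =>
      rw [Nat.testBit_add_one, toN, show (2 * toN l + a % 2) / 2 = toN l by omega, ih,
        show get (a :: l) (j + 1) = get l j by simp [get]]

/-- Starting from `Z` (the disjunction of `s` shifts), form the disjunction of `p` shifts. -/
def run : ℕ → ℕ → ℕ → ℕ → ℕ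
  | 0, _, _, Z => Z
  | k + 1, s, p, Z =>
    bif Nat.ble (2 * s) p then run k (2 * s) p (Z ||| (Z >>> s)) else (Z ||| (Z >>> (p - s)))

theorem run_spec (X k s p Z : ℕ) (hs : s ≤ p)
    (hZ : ∀ r, Z.testBit r = true → ∃ j < s, X.testBit (r + j) = true) (r : ℕ)
    (h : (run k s p Z).testBit r = true) : ∃ j < p, X.testBit (r + j) = true := by
  have step : ∀ d r, (Z ||| (Z >>> d)).testBit r = true →
      ∃ j < s + d, X.testBit (r + j) = true := by
    intro d r h
    rw [Nat.testBit_or, Bool.or_eq_true, Nat.testBit_shiftRight] at h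
    rcases h with h | h
    · obtain ⟨j, hj, h⟩ := hZ _ h
      exact ⟨j, by omega, h⟩
    · obtain ⟨j, hj, h⟩ := hZ _ h
      exact ⟨d + j, by omega, by rwa [show r + (d + j) = d + r + j by omega]⟩
  induction k generalizing s Z with
  | zero =>
    obtain ⟨j, hj, h⟩ := hZ _ h
    exact ⟨j, by omega, h⟩
  | succ k ih =>
    rw [run] at h
    cases hb : Nat.ble (2 * s) p with
    | false =>
      rw [hb, cond_false] at h
      obtain ⟨j, hj, h⟩ := step _ _ h
      exact ⟨j, by omega, h⟩
    | true =>
      rw [hb, cond_true] at h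
      have hle := Nat.le_of_ble_eq_true hb
      have hZ' : ∀ r, (Z ||| (Z >>> s)).testBit r = true →
          ∃ j < 2 * s, X.testBit (r + j) = true := by
        intro r h
        obtain ⟨j, hj, h⟩ := step _ _ h
        exact ⟨j, by omega, h⟩
      refine ih (2 * s) _ hle hZ' h ?_
      intro d r h
      rw [Nat.testBit_or, Bool.or_eq_true, Nat.testBit_shiftRight (Z ||| (Z >>> s))] at h
      rcases h with h | h
      · obtain ⟨j, hj, h⟩ := hZ' _ h
        exact ⟨j, by omega, h⟩
      · obtain ⟨j, hj, h⟩ := hZ' _ h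
        exact ⟨d + j, by omega, by rwa [show r + (d + j) = d + r + j by omega]⟩

/-- No square of period `p` starts in the first 50 letters. -/
def perP (N p : ℕ) : Bool :=
  Nat.beq (run 7 1 p (N ^^^ (N >>> p)) % 2 ^ 50) (2 ^ 50 - 1)

theorem perP_spec (W : List ℕ) (p r : ℕ) (hp : 0 < p) (hr : r < 50)
    (h : perP (toN W) p = true) (he : ∀ j < p, get W (r + j) = get W (r + p + j)) : False := by
  have h1 := Nat.eq_of_beq_eq_true h
  have h2 := congrArg (fun n => Nat.testBit n r) h1
  simp only [Nat.testBit_mod_two_pow, Nat.testBit_two_pow_sub_one, hr, decide_true,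
    Bool.true_and] at h2
  obtain ⟨j, hj, h3⟩ := run_spec (toN W ^^^ (toN W >>> p)) 7 1 p _ hp
    (fun r h => ⟨0, by omega, h⟩) r h2
  rw [Nat.testBit_xor, Nat.testBit_shiftRight, testBit_toN, testBit_toN, he j hj,
    show p + (r + j) = r + p + j by omega] at h3
  simp at h3

theorem bin_chk : (F5.all fun f => (List.range 96).all fun d =>
    perP (toN (f.flatMap bin)) (d + 3)) = true := by
  decide +kernel

def v (n : ℕ) : ℕ := get (bin (t (n / 50))) (n % 50)

theorem bin_lt (a j : ℕ) : get (bin a) j < 2 := by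
  have key : ∀ l : List ℕ, (l.all fun x => Nat.blt x 2) = true → get l j < 2 := by
    intro l hl
    unfold get
    cases hx : l[j]? with
    | none => simp
    | some x =>
      have := List.all_eq_true.1 hl x (List.mem_of_getElem? hx)
      simpa [Nat.blt_eq] using this
  apply key
  match a with
  | 0 => decide +kernel
  | 1 => decide +kernel
  | _ + 2 => exact (by decide +kernel : ((bin 2).all fun x => Nat.blt x 2) = true)

theorem v_sq (i p : ℕ) (hp : 0 < p) (hs : Sq v i p) :
    p = 1 ∨ (p = 2 ∧ v i = 0 ∧ v (i + 1) = 1) := by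
  have himg : Img 50 bin t v := fun _ => rfl
  by_cases hb : p ≤ 2
  · obtain ⟨l, hl, h⟩ := small himg (by omega) bin_len t_win _ bin_chk2 (by omega) i p hp hb hs
    have h0 := hl 0 (by omega)
    have h1 := hl 1 (by omega)
    simp only [okB, Bool.or_eq_true, Bool.and_eq_true, Nat.beq_eq, h0, h1, add_zero] at h
    exact h
  by_cases hb2 : p ≤ 98
  · exfalso
    have hc := bin_chk
    simp only [List.all_eq_true, List.mem_range] at hc
    have h1 := hc _ (t_win (i / 50)) (p - 3) (by omega)
    rw [show p - 3 + 3 = p by omega] at h1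
    refine perP_spec _ p (i % 50) hp (by omega) h1 ?_
    intro j hj
    rw [himg.win (by omega) bin_len _ _ (by omega), himg.win (by omega) bin_len _ _ (by omega)]
    have := hs j hj
    convert this using 2 <;> omega
  · obtain ⟨i', k, hk, hkp, hsq⟩ := big himg (by omega) bin_len t_win bin_sync bin_lc
      bin_inj i p (by omega) hs
    exact absurd hsq (t_sqfree k hk i')

end FS

/-- Fraenkel–Simpson theorem: there is an infinite binary word (with
`a = false`, `b = true`) whose only square factors are `aa`, `bb` and `abab`:
every factor of the form `xx` with `x` nonempty equals `aa`, `bb` or `abab`. -/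
theorem exists_infinite_binary_word_three_squares :
    ∃ w : ℕ → Bool, ∀ (i : ℕ) (x : List Bool), x ≠ [] →
      (List.ofFn fun j : Fin (2 * x.length) => w (i + j)) = x ++ x →
      x ++ x = [false, false] ∨ x ++ x = [true, true] ∨
        x ++ x = [false, true, false, true] := by
  refine ⟨fun n => Nat.beq (FS.v n) 1, ?_⟩
  intro i x hx h
  have hpos : 0 < x.length := List.length_pos_iff.2 hx
  have hget : ∀ j < 2 * x.length, (x ++ x)[j]? = some (Nat.beq (FS.v (i + j)) 1) := by
    intro j hj
    rw [← h, List.getElem?_ofFn]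
    simp [hj]
  have hs : FS.Sq FS.v i x.length := by
    intro j hj
    have h1 := hget j (by omega)
    have h2 := hget (x.length + j) (by omega)
    rw [List.getElem?_append_left hj] at h1
    rw [List.getElem?_append_right (by omega), Nat.add_sub_cancel_left, h1] at h2
    have b1 : FS.v (i + j) < 2 := FS.bin_lt _ _
    have b2 : FS.v (i + x.length + j) < 2 := FS.bin_lt _ _
    rw [← add_assoc] at h2
    generalize FS.v (i + j) = A at *
    generalize FS.v (i + x.length + j) = B at *
    interval_cases A <;> interval_cases B <;> simp_all
  rcases FS.v_sq i _ hpos hs with h1 | ⟨h1, h2, h3⟩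
  · obtain ⟨a, rfl⟩ := List.length_eq_one_iff.1 h1
    cases a <;> simp
  · obtain ⟨a, b, rfl⟩ := List.length_eq_two.1 h1
    have e0 := hget 0 (by simp)
    have e1 := hget 1 (by simp)
    simp [h2, h3] at e0 e1
    simp [e0, e1]
    rfl
end

section
/- The longest binary word containing at most one distinct square factor has length 7: the word aaabaaa has exactly one distinct square factor (namely aa), and every binary word of length 8 contains at least two distinct square factors. -/
/-- The set of distinct square factors of a word `w`: the nonempty words of the
form `x ++ x` occurring as factors of `w`. -/
def squareFactors {α : Type*} (w : List α) : Set (List α) :=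
  {u | (∃ x : List α, x ≠ [] ∧ u = x ++ x) ∧ u <:+: w}

/-- Boolean test for being a nonempty square. -/
def sqTest (u : List Bool) : Bool :=
  (u != []) && (u.take (u.length / 2) == u.drop (u.length / 2))

/-- Computable list of the square factors. -/
def sqList (w : List Bool) : List (List Bool) :=
  (w.tails.flatMap List.inits).filter sqTest

theorem sqTest_iff (u : List Bool) :
    sqTest u = true ↔ ∃ x : List Bool, x ≠ [] ∧ u = x ++ x := by
  simp only [sqTest, Bool.and_eq_true, bne_iff_ne, beq_iff_eq]
  constructor
  · rintro ⟨h, e⟩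
    have h2 : u = u.take (u.length / 2) ++ u.take (u.length / 2) := by
      conv_lhs => rw [← List.take_append_drop (u.length / 2) u, ← e]
    refine ⟨_, ?_, h2⟩
    intro h0
    rw [h0] at h2
    exact h h2
  · rintro ⟨x, hx, rfl⟩
    have : (x ++ x).length / 2 = x.length := by
      rw [List.length_append]; omega
    rw [this]
    simp [hx]

theorem mem_sqList (w u : List Bool) : u ∈ sqList w ↔ u ∈ squareFactors w := by
  simp only [sqList, List.mem_filter, List.mem_flatMap, List.mem_tails, List.mem_inits,
    sqTest_iff, squareFactors, Set.mem_setOf_eq, List.infix_iff_prefix_suffix]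
  constructor
  · rintro ⟨⟨t, h1, h2⟩, h⟩
    exact ⟨h, t, h2, h1⟩
  · rintro ⟨h, t, h2, h1⟩
    exact ⟨⟨t, h1, h2⟩, h⟩

theorem squareFactors_eq (w : List Bool) :
    squareFactors w = ((sqList w).toFinset : Set (List Bool)) := by
  ext u
  simp [mem_sqList]

theorem all_eight : ∀ a b c d e f g h : Bool,
    2 ≤ (sqList [a, b, c, d, e, f, g, h]).toFinset.card := by
  decide +kernel

/-- The longest binary word with at most one distinct square factor has
length 7: the word `aaabaaa` (with `a = false`, `b = true`) has exactly one
distinct square factor, namely `aa`, and every binary word of length 8 contains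
at least two distinct square factors. -/
theorem longest_binary_word_one_square :
    squareFactors [false, false, false, true, false, false, false] =
      {[false, false]} ∧
    (∀ w : List Bool, w.length = 8 → 2 ≤ (squareFactors w).ncard) := by
  refine ⟨?_, ?_⟩
  · rw [squareFactors_eq]
    have : (sqList [false, false, false, true, false, false, false]).toFinset =
        {[false, false]} := by decide +kernel
    rw [this]
    simp
  · intro w hw
    rw [squareFactors_eq, Set.ncard_coe_finset]
    match w, hw with
    | [a, b, c, d, e, f, g, h], _ => exact all_eight a b c d e f g h
end

section
/- The longest binary word containing at most two distinct square factors has length 18: the word abaabbaaabbbaabbab has exactly two distinct square factors, and every binary word of length 19 contains at least three distinct square factors. -/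
/-- The word `abaabbaaabbbaabbab` (with `a = false`, `b = true`). -/
def fsWord : List Bool :=
  [false, true, false, false, true, true, false, false, false,
   true, true, true, false, false, true, true, false, true]

/-- The squares that are prefixes of `w`. -/
def prefSq (w : List Bool) : List (List Bool) :=
  ((List.range (w.length / 2 + 1)).filter
    (fun k => (0 < k ∧ k + k ≤ w.length) ∧ w.take k = (w.drop k).take k)).map
      (fun k => w.take k ++ w.take k)

/-- Backtracking search: every extension of `w` to the left by `n` letters gets three squares. -/
def search : ℕ → List Bool → List (List Bool) → Bool
  | 0, w, s => decide (3 ≤ (prefSq w ∪ s).length)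
  | n + 1, w, s =>
    decide (3 ≤ (prefSq w ∪ s).length) ||
      (search n (false :: w) (prefSq w ∪ s) && search n (true :: w) (prefSq w ∪ s))

theorem prefSq_sub (w : List Bool) : ∀ u ∈ prefSq w, u ∈ squareFactors w := by
  intro u hu
  simp only [prefSq, List.mem_map, List.mem_filter, decide_eq_true_eq] at hu
  obtain ⟨k, ⟨-, ⟨hk, hl⟩, he⟩, rfl⟩ := hu
  refine ⟨⟨w.take k, ?_, rfl⟩, ?_⟩
  · intro h
    have := congrArg List.length h
    simp at this
    rcases this with h | h
    · omega
    · subst h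
      simp at hl
      omega
  · refine ⟨[], (w.drop k).drop k, ?_⟩
    nth_rewrite 2 [he]
    simp only [List.nil_append, List.append_assoc, List.take_append_drop]

theorem squareFactors_mono {v w : List Bool} (h : v <:+: w) :
    squareFactors v ⊆ squareFactors w := fun _ hu => ⟨hu.1, hu.2.trans h⟩

theorem squareFactors_finite (w : List Bool) : (squareFactors w).Finite := by
  refine (List.finite_toSet (w.tails.flatMap List.inits)).subset ?_
  rintro u ⟨-, hi⟩
  obtain ⟨t, ht, hs⟩ := List.infix_iff_prefix_suffix.mp hi
  exact List.mem_flatMap.mpr ⟨t, (List.mem_tails _ _).mpr hs, (List.mem_inits _ _).mpr ht⟩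

theorem ncard_of_list {w : List Bool} {s : List (List Bool)} (hn : s.Nodup)
    (hs : ∀ u ∈ s, u ∈ squareFactors w) (h3 : 3 ≤ s.length) :
    3 ≤ (squareFactors w).ncard := by
  rw [← List.toFinset_card_of_nodup hn, ← Set.ncard_coe_finset] at h3
  refine h3.trans (Set.ncard_le_ncard ?_ (squareFactors_finite w))
  intro u hu
  exact hs u (by simpa using hu)

theorem search_sound (n : ℕ) : ∀ (w : List Bool) (s : List (List Bool)), s.Nodup →
    (∀ u ∈ s, u ∈ squareFactors w) → search n w s = true →
    ∀ v : List Bool, v.length = n → 3 ≤ (squareFactors (v.reverse ++ w)).ncard := by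
  induction n with
  | zero =>
    intro w s hn hs h v hv
    obtain rfl := List.length_eq_zero_iff.mp hv
    simp only [search, decide_eq_true_eq] at h
    refine ncard_of_list (hn.union _) ?_ h
    intro u hu
    rcases List.mem_union_iff.mp hu with hu | hu
    · exact prefSq_sub w u hu
    · exact hs u hu
  | succ n ih =>
    intro w s hn hs h v hv
    have hs' : ∀ u ∈ prefSq w ∪ s, u ∈ squareFactors w := by
      intro u hu
      rcases List.mem_union_iff.mp hu with hu | hu
      · exact prefSq_sub w u hu
      · exact hs u hu
    simp only [search, Bool.or_eq_true, Bool.and_eq_true, decide_eq_true_eq] at h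
    rcases h with h | ⟨hf, ht⟩
    · refine ncard_of_list (hn.union _) (fun u hu => ?_) h
      exact squareFactors_mono (List.suffix_append _ _).isInfix (hs' u hu)
    · cases v with
      | nil => simp at hv
      | cons c v =>
        have hm : ∀ c : Bool, ∀ u ∈ prefSq w ∪ s, u ∈ squareFactors (c :: w) := fun c u hu =>
          squareFactors_mono (List.suffix_cons c w).isInfix (hs' u hu)
        have hv' : v.length = n := by simpa using hv
        rw [List.reverse_cons, List.append_assoc, List.singleton_append]
        cases c
        · exact ih _ _ (hn.union _) (hm _) hf v hv'
        · exact ih _ _ (hn.union _) (hm _) ht v hv'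

theorem search_true : search 19 [] [] = true := by decide +kernel

theorem fs_check : ∀ u ∈ fsWord.tails.flatMap List.inits,
    u ≠ [] → u.take (u.length / 2) = u.drop (u.length / 2) →
      u = [false, false] ∨ u = [true, true] := by decide +kernel

theorem fs_eq : squareFactors fsWord = {[false, false], [true, true]} := by
  ext u
  simp only [Set.mem_insert_iff, Set.mem_singleton_iff]
  constructor
  · rintro ⟨⟨x, hx, rfl⟩, hi⟩
    refine fs_check _ ?_ (by simp [hx]) ?_
    · obtain ⟨t, ht, hs⟩ := List.infix_iff_prefix_suffix.mp hi
      exact List.mem_flatMap.mpr ⟨t, (List.mem_tails _ _).mpr hs, (List.mem_inits _ _).mpr ht⟩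
    · have : (x ++ x).length / 2 = x.length := by simp; omega
      rw [this]; simp
  · rintro (rfl | rfl)
    · exact ⟨⟨[false], by simp, rfl⟩, by decide +kernel⟩
    · exact ⟨⟨[true], by simp, rfl⟩, by decide +kernel⟩

/-- The longest binary word with at most two distinct square factors has
length 18: the word `abaabbaaabbbaabbab` has exactly two distinct square
factors, and every binary word of length 19 contains at least three distinct
square factors. -/
theorem longest_binary_word_two_squares :
    (squareFactors fsWord).ncard = 2 ∧
    (∀ w : List Bool, w.length = 19 → 3 ≤ (squareFactors w).ncard) := by
  refine ⟨?_, fun w hw => ?_⟩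
  · rw [fs_eq]
    exact Set.ncard_pair (by decide)
  · have := search_sound 19 [] [] List.nodup_nil (by simp) search_true w.reverse (by simpa using hw)
    simpa using this
end

section
/- The longest ternary word containing no abelian square has length 7: the word abacaba contains no abelian square factor, and every word of length 8 over a three-letter alphabet contains an abelian square factor. -/
/-- Boolean test for equal letter counts of the two blocks of length `n` starting at `i`. -/
def blocksEq (w : List (Fin 3)) (i n : ℕ) : Bool :=
  let x := (w.drop i).take n
  let y := (w.drop (i + n)).take n
  x.count 0 == y.count 0 && (x.count 1 == y.count 1 && x.count 2 == y.count 2)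

/-- The word has a prefix that is an abelian square of half-length at most four. -/
def squarePrefix (w : List (Fin 3)) : Bool :=
  [1, 2, 3, 4].any fun n => decide (2 * n ≤ w.length) && blocksEq w 0 n

/-- Every extension of `w` by `k` letters on the left meets an abelian square. -/
def searchLeft : ℕ → List (Fin 3) → Bool
  | 0, w => squarePrefix w
  | k + 1, w => squarePrefix w ||
      (searchLeft k (0 :: w) && (searchLeft k (1 :: w) && searchLeft k (2 :: w)))

theorem squarePrefix_sound (w : List (Fin 3)) (h : squarePrefix w = true) :
    ∃ u, u <+: w ∧ AbelianSquare u := by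
  unfold squarePrefix at h
  rw [List.any_eq_true] at h
  obtain ⟨n, hn, h⟩ := h
  have hn1 : 1 ≤ n := by
    simp at hn
    omega
  simp only [blocksEq, Bool.and_eq_true, decide_eq_true_eq, beq_iff_eq, List.drop_zero,
    Nat.zero_add] at h
  obtain ⟨hl, h0, h1, h2⟩ := h
  refine ⟨w.take n ++ (w.drop n).take n, ⟨(w.drop n).drop n, ?_⟩, w.take n, (w.drop n).take n,
    ?_, ?_, ?_, rfl⟩
  · rw [List.append_assoc, List.take_append_drop, List.take_append_drop]
  · intro h
    have := congrArg List.length h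
    simp only [List.length_take, List.length_nil] at this
    omega
  · simp only [List.length_take, List.length_drop]
    omega
  · intro a
    fin_cases a
    · exact h0
    · exact h1
    · exact h2

theorem searchLeft_sound (k : ℕ) : ∀ w : List (Fin 3), searchLeft k w = true →
    ∀ v : List (Fin 3), v.length = k → ∃ u, u <:+: v.reverse ++ w ∧ AbelianSquare u := by
  have base : ∀ w v : List (Fin 3), squarePrefix w = true →
      ∃ u, u <:+: v.reverse ++ w ∧ AbelianSquare u := by
    intro w v h
    obtain ⟨u, hu, hs⟩ := squarePrefix_sound w h
    exact ⟨u, hu.isInfix.trans (List.suffix_append _ _).isInfix, hs⟩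
  induction k with
  | zero => exact fun w h v _ => base w v h
  | succ k ih =>
    intro w h v hv
    simp only [searchLeft, Bool.or_eq_true, Bool.and_eq_true] at h
    rcases h with h | ⟨h0, h1, h2⟩
    · exact base w v h
    · cases v with
      | nil => simp at hv
      | cons a v =>
        have ha : searchLeft k (a :: w) = true := by
          fin_cases a
          · exact h0
          · exact h1
          · exact h2
        have := ih (a :: w) ha v (by simpa using hv)
        simpa using this

theorem abacaba_blocks : ∀ i < 8, ∀ n < 8, 1 ≤ n → i + 2 * n ≤ 7 →
    blocksEq [0, 1, 0, 2, 0, 1, 0] i n = false := by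
  decide +kernel

theorem search_eight : searchLeft 8 [] = true := by
  decide +kernel

/-- The longest ternary word with no abelian square factor has length 7: the
word `abacaba` (with `a = 0`, `b = 1`, `c = 2`) has no abelian square factor,
and every ternary word of length 8 has an abelian square factor. -/
theorem longest_ternary_abelian_square_free :
    (∀ u : List (Fin 3), u <:+: [0, 1, 0, 2, 0, 1, 0] → ¬ AbelianSquare u) ∧
    (∀ w : List (Fin 3), w.length = 8 → ∃ u : List (Fin 3),
      u <:+: w ∧ AbelianSquare u) := by
  constructor
  · rintro u ⟨s, t, hst⟩ ⟨x, y, hx, hlen, hp, rfl⟩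
    have hpos : 0 < x.length := List.length_pos_iff.mpr hx
    have hl := congrArg List.length hst
    simp only [List.length_append, List.length_cons, List.length_nil] at hl
    have hb := abacaba_blocks s.length (by omega) x.length (by omega) hpos (by omega)
    have e1 : ((s ++ (x ++ y) ++ t).drop s.length).take x.length = x := by
      simp [List.append_assoc]
    have e2 : ((s ++ (x ++ y) ++ t).drop (s.length + x.length)).take x.length = y := by
      rw [← List.drop_drop, hlen]
      simp [List.append_assoc, ← hlen]
    rw [← hst] at hb
    simp only [blocksEq, e1, e2, hp 0, hp 1, hp 2] at hb
    simp at hb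
  · intro w hw
    have := searchLeft_sound 8 [] search_eight w.reverse (by simpa using hw)
    simpa using this
end
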